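/- arXiv:2211.07822 — 4 statements merged into one kernel-verified Lean document; each statement's English description precedes it below -/
import Mathlib

section
/- Let k be an even positive integer and let G be an 𝓛_k-free graph on n vertices with minimum degree at least d. If n > k^5, 2 ≤ r ≤ ⌊(k-3)/2⌋ and N_r(G) > max{ h_r(n,k,d), h_r(n,k,⌊(k-5)/2⌋) }, then G is isomorphic to a subgraph of H(n, k, ⌊(k-1)/2⌋), of H(n, k, ⌊(k-3)/2⌋), of H^+(n, k-1, ⌊(k-3)/2⌋), or of H^{++}(n, k-2, ⌊(k-3)/2⌋). -/
open SimpleGraph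

/-- The degree of a vertex `v` in a graph `G` (as the cardinality of its neighbor set). -/
noncomputable def degN {V : Type*} (G : SimpleGraph V) (v : V) : ℕ :=
  (G.neighborSet v).ncard

/-- A linear forest: an acyclic graph all of whose vertices have degree at most `2`,
i.e. a forest whose connected components are paths and isolated vertices. -/
def IsLinearForest {V : Type*} (H : SimpleGraph V) : Prop :=
  H.IsAcyclic ∧ ∀ v, degN H v ≤ 2

/-- `G` is `𝓛ₖ`-free: it contains no linear forest with exactly `k` edges as a subgraph. -/
def LinearForestFree {V : Type*} (k : ℕ) (G : SimpleGraph V) : Prop :=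
  ∀ H : SimpleGraph V, H ≤ G → IsLinearForest H → H.edgeSet.ncard ≠ k

/-- `Nr r G` is the number of `r`-cliques of `G`. -/
noncomputable def Nr {V : Type*} (r : ℕ) (G : SimpleGraph V) : ℕ :=
  {s : Finset V | G.IsNClique r s}.ncard

/-- `hr r n k a = C(k-a, r) + (n-k+a) * C(a, r-1)` (as an integer). -/
def hr (r n k a : ℕ) : ℤ :=
  (Nat.choose (k - a) r : ℤ) + ((n : ℤ) - (k : ℤ) + (a : ℤ)) * (Nat.choose a (r - 1) : ℤ)

/-- The graph `H(n,k,a)`: vertices `0,…,a-1` form the set `A`, vertices `a,…,k-a-1` form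
the set `B`, the remaining `n-k+a` vertices form the set `C`; the edges are all edges inside
`A ∪ B` together with all edges between `A` and `C`. -/
def HGraph (n k a : ℕ) : SimpleGraph (Fin n) :=
  SimpleGraph.fromRel (fun u v => (u : ℕ) < a ∨ ((u : ℕ) < k - a ∧ (v : ℕ) < k - a))

/-- `H⁺(n,k,a)`: the graph `H(n,k,a)` with one extra edge inside `C`
(between the first two vertices of `C`). -/
def HplusGraph (n k a : ℕ) : SimpleGraph (Fin n) :=
  SimpleGraph.fromRel (fun u v => (u : ℕ) < a ∨ ((u : ℕ) < k - a ∧ (v : ℕ) < k - a)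
    ∨ ((u : ℕ) = k - a ∧ (v : ℕ) = k - a + 1))

/-- `H⁺⁺(n,k,a)`: the graph `H(n,k,a)` with two extra independent edges inside `C`. -/
def HplusplusGraph (n k a : ℕ) : SimpleGraph (Fin n) :=
  SimpleGraph.fromRel (fun u v => (u : ℕ) < a ∨ ((u : ℕ) < k - a ∧ (v : ℕ) < k - a)
    ∨ ((u : ℕ) = k - a ∧ (v : ℕ) = k - a + 1)
    ∨ ((u : ℕ) = k - a + 2 ∧ (v : ℕ) = k - a + 3))

/-- `G` is isomorphic to a subgraph of `H`. -/
def IsoSubgraph {V W : Type*} (G : SimpleGraph V) (H : SimpleGraph W) : Prop :=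
  ∃ f : V ↪ W, ∀ u v, G.Adj u v → H.Adj (f u) (f v)

namespace LinearForestStability

open scoped Classical

section Basic

variable {V : Type*}

/-- The indicator of adjacency. -/
noncomputable def adjInd (G : SimpleGraph V) (a b : V) : ℕ := if G.Adj a b then 1 else 0

/-- The number of consecutive entries of a list which are adjacent. For a list without
repetitions these pairs form a linear forest. -/
noncomputable def adjCount (G : SimpleGraph V) : List V → ℕ
  | [] => 0
  | [_] => 0
  | a :: b :: l => adjInd G a b + adjCount G (b :: l)

/-- Every linear forest of `G` has at most `t` edges. -/
def LinearForestBound (G : SimpleGraph V) (t : ℕ) : Prop :=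
  ∀ L : List V, L.Nodup → adjCount G L ≤ t

/-- The graph `G` with all edges meeting `X` removed. -/
def isolate (G : SimpleGraph V) (X : Finset V) : SimpleGraph V where
  Adj a b := G.Adj a b ∧ a ∉ X ∧ b ∉ X
  symm := ⟨fun _ _ h => ⟨h.1.symm, h.2.2, h.2.1⟩⟩
  loopless := ⟨fun _ h => h.1.ne rfl⟩

lemma isolate_adj {G : SimpleGraph V} {X : Finset V} {a b : V} :
    (isolate G X).Adj a b ↔ G.Adj a b ∧ a ∉ X ∧ b ∉ X := Iff.rfl

lemma isolate_le (G : SimpleGraph V) (X : Finset V) : isolate G X ≤ G := fun _ _ h => h.1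

lemma isolate_mono {G H : SimpleGraph V} (h : G ≤ H) (X : Finset V) :
    isolate G X ≤ isolate H X := fun _ _ hab => ⟨h hab.1, hab.2⟩

lemma isolate_isolate (G : SimpleGraph V) (X Y : Finset V) :
    isolate (isolate G X) Y = isolate G (X ∪ Y) := by
  ext a b
  simp only [isolate_adj, Finset.mem_union]
  tauto

section AdjCount

variable {G H : SimpleGraph V}

lemma adjInd_le_one (a b : V) : adjInd G a b ≤ 1 := by
  unfold adjInd; split_ifs <;> simp

lemma adjInd_of_adj {a b : V} (h : G.Adj a b) : adjInd G a b = 1 := if_pos h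

lemma adjInd_of_not_adj {a b : V} (h : ¬ G.Adj a b) : adjInd G a b = 0 := if_neg h

@[simp] lemma adjInd_self (a : V) : adjInd G a a = 0 := by simp [adjInd]

lemma adjInd_comm (a b : V) : adjInd G a b = adjInd G b a := by simp [adjInd, G.adj_comm]

lemma adjInd_mono (h : G ≤ H) (a b : V) : adjInd G a b ≤ adjInd H a b := by
  unfold adjInd
  split_ifs with h1 h2 <;> first | exact absurd (h h1) h2 | simp

@[simp] lemma adjCount_nil : adjCount G [] = 0 := rfl

@[simp] lemma adjCount_singleton (a : V) : adjCount G [a] = 0 := rfl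

@[simp] lemma adjCount_cons_cons (a b : V) (l : List V) :
    adjCount G (a :: b :: l) = adjInd G a b + adjCount G (b :: l) := rfl

lemma adjCount_mono (h : G ≤ H) : ∀ L : List V, adjCount G L ≤ adjCount H L
  | [] => le_rfl
  | [_] => le_rfl
  | a :: b :: l => Nat.add_le_add (adjInd_mono h a b) (adjCount_mono h (b :: l))

lemma adjCount_append_cons (a b : V) (l : List V) : ∀ l' : List V,
    adjCount G (l' ++ a :: b :: l) = adjCount G (l' ++ [a]) + adjInd G a b + adjCount G (b :: l)
  | [] => by simp
  | [c] => by simp; ring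
  | c :: d :: l' => by
    have := adjCount_append_cons a b l (d :: l')
    simp only [List.cons_append, adjCount_cons_cons] at this ⊢
    omega

lemma adjCount_join {L M : List V} {a b : V} (hL : L.getLast? = some a) (hM : M.head? = some b) :
    adjCount G (L ++ M) = adjCount G L + adjInd G a b + adjCount G M := by
  obtain ⟨L', rfl⟩ := List.getLast?_eq_some_iff.1 hL
  obtain ⟨M', rfl⟩ := List.head?_eq_some_iff.1 hM
  simpa using adjCount_append_cons (G := G) a b M' L'

lemma le_adjCount_append (L M : List V) :
    adjCount G L + adjCount G M ≤ adjCount G (L ++ M) := by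
  rcases hL : L.getLast? with _ | a
  · simp [List.getLast?_eq_none_iff.1 hL]
  rcases hM : M.head? with _ | b
  · simp [List.head?_eq_none_iff.1 hM]
  rw [adjCount_join hL hM]
  omega

lemma adjCount_reverse : ∀ L : List V, adjCount G L.reverse = adjCount G L
  | [] => rfl
  | [_] => rfl
  | a :: b :: l => by
    have h := adjCount_reverse (b :: l)
    rw [List.reverse_cons, adjCount_join (a := b) (b := a) (by simp) (by simp), h]
    simp [adjInd_comm a b]
    ring

lemma adjCount_le_cons (a : V) (L : List V) : adjCount G L ≤ adjCount G (a :: L) := by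
  simpa using le_adjCount_append (G := G) [a] L

/-- Deleting isolated vertices from a list does not lower the number of adjacent pairs. -/
lemma adjCount_le_filter {p : V → Prop} (hp : ∀ a b, G.Adj a b → p a) : ∀ L : List V,
    adjCount G L ≤ adjCount G (L.filter fun a => p a)
  | [] => le_rfl
  | [_] => by simp
  | a :: b :: l => by
    have ih := adjCount_le_filter hp (b :: l)
    by_cases ha : p a
    · by_cases hb : p b
      · simp only [List.filter_cons, ha, hb, decide_true, if_true, adjCount_cons_cons] at ih ⊢
        omega
      · have h0 : adjInd G a b = 0 := adjInd_of_not_adj fun h => hb (hp _ _ h.symm)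
        rw [adjCount_cons_cons, h0, zero_add]
        refine ih.trans ?_
        rw [List.filter_cons (x := a)]
        simpa only [ha, decide_true, if_true] using adjCount_le_cons _ _
    · have h0 : adjInd G a b = 0 := adjInd_of_not_adj fun h => ha (hp _ _ h)
      rw [adjCount_cons_cons, h0, zero_add, List.filter_cons (x := a)]
      simpa only [ha, decide_false, Bool.false_eq_true, if_false] using ih

lemma exists_restrict {p : V → Prop} (hp : ∀ a b, G.Adj a b → p a) {L : List V}
    (hL : L.Nodup) : ∃ M : List V, M.Nodup ∧ (∀ x ∈ M, p x) ∧ adjCount G L ≤ adjCount G M :=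
  ⟨L.filter fun a => p a, hL.filter _, by simp, adjCount_le_filter hp L⟩

/-- If `f a + g b` is at most the adjacency indicator of each consecutive pair `(a, b)`, then the
total of `f` and `g` is bounded by the number of adjacent pairs, up to the two ends. -/
lemma sum_add_sum_le_adjCount {f g : V → ℕ} : ∀ (a : V) (L : List V),
    (∀ L₁ x y L₂, a :: L = L₁ ++ x :: y :: L₂ → f x + g y ≤ adjInd G x y) →
    (∀ x, (a :: L).getLast? = some x → f x = 0) →
    ((a :: L).map f).sum + (L.map g).sum ≤ adjCount G (a :: L)
  | a, [], _, hl => by simpa using hl a rfl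
  | a, b :: l, h, hl => by
    have ih := sum_add_sum_le_adjCount b l
      (fun L₁ x y L₂ e => h (a :: L₁) x y L₂ (by rw [e]; rfl))
      (fun x hx => hl x (by rw [List.getLast?_cons_cons]; exact hx))
    have h1 := h [] a b l rfl
    simp only [List.map_cons, List.sum_cons, adjCount_cons_cons] at ih ⊢
    omega

end AdjCount

end Basic

section Closure

variable {V : Type*} [Fintype V] {G : SimpleGraph V} {t : ℕ}

/-- The neighbours of a vertex, as a finset. -/
noncomputable def nbrs (G : SimpleGraph V) (v : V) : Finset V := Finset.univ.filter (G.Adj v)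

lemma mem_nbrs {u v : V} : u ∈ nbrs G v ↔ G.Adj v u := by simp [nbrs]

omit [Fintype V] in
lemma sum_map_adjInd (v : V) {L : List V} (hL : L.Nodup) :
    (L.map (adjInd G v)).sum = (L.toFinset.filter (G.Adj v)).card := by
  rw [← List.sum_toFinset _ hL, Finset.card_filter]
  rfl

lemma sum_map_adjInd_eq_card_nbrs (v : V) {L : List V} (hL : L.Nodup)
    (hmem : ∀ x, G.Adj v x → x ∈ L) : (L.map (adjInd G v)).sum = (nbrs G v).card := by
  rw [sum_map_adjInd v hL]
  congr 1
  ext x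
  simpa [nbrs] using hmem x

omit [Fintype V] in
/-- Every list without repetitions extends to one through any given set of vertices. -/
lemma exists_extension (S : Finset V) {L : List V} (hL : L.Nodup) :
    ∃ R : List V, (L ++ R).Nodup ∧ (∀ x ∈ S, x ∈ L ++ R) ∧ ∀ x ∈ R, x ∈ S := by
  refine ⟨(S.filter (· ∉ L)).toList, ?_, ?_, ?_⟩
  · rw [List.nodup_append]
    refine ⟨hL, Finset.nodup_toList _, fun a ha b hb => ?_⟩
    rintro rfl
    simp [ha] at hb
  · intro x hx
    by_cases h : x ∈ L <;> simp [h, hx]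
  · simp +contextual

/-- The two-switch argument behind the closure operation for linear forests. -/
lemma card_nbrs_add_card_nbrs_le_of_split (hG : LinearForestBound G t) {u v : V}
    {P Q : List V} (hP : P.getLast? = some u) (hQ : Q.head? = some v)
    (hnd : (P ++ Q).Nodup) (hall : ∀ x, x ∈ P ++ Q) (ht : t ≤ adjCount G P + adjCount G Q) :
    (nbrs G u).card + (nbrs G v).card ≤ t := by
  have hbound : ∀ N : List V, N.Perm (P ++ Q) → adjCount G N ≤ t :=
    fun N h => hG N (h.nodup_iff.2 hnd)
  have hPsum : (P.map (adjInd G u)).sum + (P.map (adjInd G v)).sum ≤ adjCount G P := by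
    obtain ⟨c, P', rfl⟩ : ∃ c P', P = c :: P' := by
      cases P with
      | nil => simp at hP
      | cons c P' => exact ⟨c, P', rfl⟩
    have hc : adjInd G v c = 0 := by
      have h := hbound ((c :: P').reverse ++ Q) ((List.reverse_perm _).append_right _)
      rw [adjCount_join (a := c) (b := v) (by simp) hQ, adjCount_reverse] at h
      rw [adjInd_comm]
      omega
    have := sum_add_sum_le_adjCount (G := G) (f := adjInd G u) (g := adjInd G v) c P' ?_ ?_
    · simp only [List.map_cons, List.sum_cons, hc] at this ⊢
      omega
    · intro L₁ x y L₂ e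
      have h := hbound ((L₁ ++ [x]) ++ ((y :: L₂).reverse ++ Q)) (by
        rw [e, ← List.append_assoc]
        refine List.Perm.append_right _ ?_
        simpa using ((List.reverse_perm (y :: L₂)).append_left (L₁ ++ [x])))
      rw [e] at hP ht
      have hlast : (y :: L₂).getLast? = some u := by
        simpa [List.getLast?_append, List.getLast?_cons_cons] using hP
      rw [adjCount_join (a := x) (b := u) (by simp)
          (by rw [List.head?_append, List.head?_reverse, hlast]; rfl),
        adjCount_join (a := y) (b := v) (by simp) hQ, adjCount_reverse] at h
      rw [adjCount_append_cons] at ht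
      rw [adjInd_comm u x, adjInd_comm v y]
      omega
    · intro x hx
      rw [hP] at hx
      cases hx
      simp
  have hQsum : (Q.map (adjInd G u)).sum + (Q.map (adjInd G v)).sum ≤ adjCount G Q := by
    obtain ⟨Q', rfl⟩ := List.head?_eq_some_iff.1 hQ
    have := sum_add_sum_le_adjCount (G := G) (f := adjInd G u) (g := adjInd G v) v Q' ?_ ?_
    · simp only [List.map_cons, List.sum_cons, adjInd_self] at this ⊢
      omega
    · intro L₁ x y L₂ e
      have h := hbound (P ++ ((L₁ ++ [x]).reverse ++ (y :: L₂))) (by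
        rw [e]
        refine List.Perm.append_left _ ?_
        simpa using ((List.reverse_perm (L₁ ++ [x])).append_right (y :: L₂)))
      rw [e] at ht
      have hhead : (L₁ ++ [x]).head? = some v := by
        have h2 : (L₁ ++ x :: y :: L₂).head? = some v := by rw [← e]; rfl
        cases L₁ <;> simpa using h2
      rw [adjCount_join (a := u) (b := x) hP (by simp),
        adjCount_join (a := v) (b := y) (by rw [List.getLast?_reverse, hhead]) (by simp),
        adjCount_reverse] at h
      rw [adjCount_append_cons] at ht
      omega
    · intro x hx
      have h := hbound (P ++ (v :: Q').reverse) ((List.reverse_perm _).append_left _)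
      rw [adjCount_join (a := u) (b := x) hP (by rw [List.head?_reverse, hx]),
        adjCount_reverse] at h
      omega
  have hu := sum_map_adjInd_eq_card_nbrs (G := G) u hnd fun x _ => hall x
  have hv := sum_map_adjInd_eq_card_nbrs (G := G) v hnd fun x _ => hall x
  have hPQ := (le_adjCount_append P Q).trans (hG _ hnd)
  simp only [List.map_append, List.sum_append] at hu hv
  omega

omit [Fintype V] in
lemma adjCount_sup_edge_of_notMem {u v : V} : ∀ {L : List V}, v ∉ L →
    adjCount (G ⊔ edge u v) L ≤ adjCount G L
  | [], _ => le_rfl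
  | [_], _ => le_rfl
  | a :: b :: l, h => by
    have ih := adjCount_sup_edge_of_notMem (u := u) (L := b :: l)
      (fun hv => h (List.mem_cons_of_mem _ hv))
    have : adjInd (G ⊔ edge u v) a b = adjInd G a b := by
      simp only [List.mem_cons, not_or] at h
      have : ¬ (edge u v).Adj a b := by
        rw [edge_adj]
        rintro ⟨⟨-, rfl⟩ | ⟨rfl, -⟩, -⟩
        · exact h.2.1 rfl
        · exact h.1 rfl
      simp [adjInd, this]
    simp only [adjCount_cons_cons]
    omega

omit [Fintype V] in
lemma adjCount_sup_edge_split {u v : V} : ∀ {L : List V}, L.Nodup →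
    adjCount (G ⊔ edge u v) L ≤ adjCount G L ∨
      ∃ X Y, (L = X ++ u :: v :: Y ∨ L = X ++ v :: u :: Y)
  | [], _ => Or.inl le_rfl
  | [_], _ => Or.inl le_rfl
  | a :: b :: l, h => by
    rcases adjCount_sup_edge_split (u := u) (v := v) (List.nodup_cons.1 h).2 with ih | ⟨X, Y, ih⟩
    · by_cases he : (edge u v).Adj a b
      · right
        rw [edge_adj] at he
        obtain ⟨⟨rfl, rfl⟩ | ⟨rfl, rfl⟩, -⟩ := he
        · exact ⟨[], l, Or.inl rfl⟩
        · exact ⟨[], l, Or.inr rfl⟩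
      · left
        have : adjInd (G ⊔ edge u v) a b = adjInd G a b := by simp [adjInd, he]
        simp only [adjCount_cons_cons]
        omega
    · right
      refine ⟨a :: X, Y, ?_⟩
      rcases ih with ih | ih
      · left; rw [ih]; rfl
      · right; rw [ih]; rfl

lemma card_nbrs_add_card_nbrs_le_of_append (hG : LinearForestBound G t) {u v : V}
    {X Y : List V} (hnd : (X ++ u :: v :: Y).Nodup)
    (ht : t < adjCount (G ⊔ edge u v) (X ++ u :: v :: Y)) :
    (nbrs G u).card + (nbrs G v).card ≤ t := by
  have hnd' : ((X ++ [u]) ++ (v :: Y)).Nodup := by simpa using hnd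
  obtain ⟨R, hR, hall, -⟩ := exists_extension Finset.univ hnd'
  rw [List.append_assoc] at hR hall
  refine card_nbrs_add_card_nbrs_le_of_split hG (by simp) (by simp) hR
    (fun x => hall x (Finset.mem_univ x)) ?_
  rw [adjCount_append_cons] at ht
  have hv : v ∉ X ++ [u] := fun h => (List.nodup_append.1 hnd').2.2 v h v (by simp) rfl
  have hu : u ∉ v :: Y := fun h => (List.nodup_append.1 hnd').2.2 u (by simp) u h rfl
  have h1 := adjCount_sup_edge_of_notMem (G := G) (u := u) hv
  have h2 := adjCount_sup_edge_of_notMem (G := G) (u := v) hu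
  rw [SimpleGraph.edge_comm] at h2
  have h3 := le_adjCount_append (G := G) (v :: Y) R
  have h4 := adjInd_le_one (G := G ⊔ edge u v) u v
  omega

/-- If joining two nonadjacent vertices creates a linear forest with more than `t` edges,
their degree sum is at most `t`. -/
lemma card_nbrs_add_card_nbrs_le (hG : LinearForestBound G t) {u v : V}
    (h : ¬ LinearForestBound (G ⊔ edge u v) t) : (nbrs G u).card + (nbrs G v).card ≤ t := by
  simp only [LinearForestBound, not_forall, not_le] at h
  obtain ⟨L, hL, ht⟩ := h
  rcases adjCount_sup_edge_split (G := G) (u := u) (v := v) hL with h | ⟨X, Y, rfl | rfl⟩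
  · exact absurd (hG L hL) (by omega)
  · exact card_nbrs_add_card_nbrs_le_of_append hG hL ht
  · rw [add_comm]
    rw [SimpleGraph.edge_comm] at ht
    exact card_nbrs_add_card_nbrs_le_of_append hG hL ht

/-- Every graph without large linear forests extends to one in which nonadjacent vertices have
small degree sum. -/
lemma exists_closed (hG : LinearForestBound G t) : ∃ H, G ≤ H ∧ LinearForestBound H t ∧
    ∀ u v, u ≠ v → ¬ H.Adj u v → (nbrs H u).card + (nbrs H v).card ≤ t := by
  obtain ⟨H, hGH, hH⟩ := (Set.toFinite {H : SimpleGraph V | LinearForestBound H t}).exists_le_maximal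
    hG
  refine ⟨H, hGH, hH.1, fun u v hne huv => card_nbrs_add_card_nbrs_le hH.1 fun hb => huv ?_⟩
  exact hH.2 hb le_sup_left (show (H ⊔ edge u v).Adj u v from Or.inr (by simp [edge_adj, hne]))

omit [Fintype V] in
/-- Either the total of `f` over a list is at most the number of adjacent pairs, or there is a
first entry with `f = 1` not followed by an adjacent one. -/
lemma sum_le_adjCount_or_split {f : V → ℕ} (hf : ∀ x, f x ≤ 1) : ∀ L : List V,
    (L.map f).sum ≤ adjCount G L ∨ ∃ L₁ a L₂, L = L₁ ++ a :: L₂ ∧ f a = 1 ∧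
      adjCount G L = adjCount G (L₁ ++ [a]) + adjCount G L₂ ∧
      (L₁.map f).sum ≤ adjCount G (L₁ ++ [a])
  | [] => by simp
  | [x] => by
    by_cases hx : f x = 1
    · exact Or.inr ⟨[], x, [], by simp [hx]⟩
    · left
      have := hf x
      simp
      omega
  | x :: y :: l => by
    by_cases hx : f x = 1 ∧ adjInd G x y = 0
    · exact Or.inr ⟨[], x, y :: l, by simp [hx.1, hx.2]⟩
    have hx' : f x ≤ adjInd G x y := by
      have := hf x
      have := adjInd_le_one (G := G) x y
      omega
    rcases sum_le_adjCount_or_split hf (y :: l) with ih | ⟨L₁, a, L₂, e, ha, hc, hs⟩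
    · left
      simp only [List.map_cons, List.sum_cons, adjCount_cons_cons] at ih ⊢
      omega
    · right
      have hh : ∃ L', L₁ ++ [a] = y :: L' := by
        cases L₁ with
        | nil => simp at e; exact ⟨[], by simp [e.1]⟩
        | cons z L₁ => simp at e; exact ⟨L₁ ++ [a], by simp [e.1]⟩
      obtain ⟨L', hL'⟩ := hh
      refine ⟨x :: L₁, a, L₂, by rw [e]; rfl, ha, ?_, ?_⟩
      · rw [List.cons_append, hL', adjCount_cons_cons, adjCount_cons_cons, hc, hL']
        omega
      · rw [List.cons_append, hL', adjCount_cons_cons, ← hL', List.map_cons, List.sum_cons]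
        omega

/-- A vertex whose deletion lowers the maximum size of a linear forest only a little has
small degree. -/
lemma card_nbrs_le (hG : LinearForestBound G t) {v : V} {L : List V} (hL : L.Nodup)
    (ht : t ≤ adjCount (isolate G {v}) L + 1) : (nbrs G v).card ≤ t := by
  obtain ⟨M₀, hM₀, hvM₀, h1⟩ := exists_restrict (G := isolate G {v}) (p := fun a => a ≠ v)
    (fun a b h => by simpa using h.2.1) hL
  have h2 := adjCount_mono (isolate_le G {v}) M₀
  obtain ⟨R, hR, hall, hmem⟩ := exists_extension (Finset.univ.erase v) hM₀
  have h3 := le_adjCount_append (G := G) M₀ R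
  have hv : v ∉ M₀ ++ R := by
    intro h
    rcases List.mem_append.1 h with h | h
    · exact hvM₀ v h rfl
    · simpa using hmem v h
  have hsum := sum_map_adjInd_eq_card_nbrs (G := G) v hR fun x hx =>
    hall x (by simp [hx.ne'])
  generalize M₀ ++ R = M at *
  by_contra! hlt
  have hMt := hG M hR
  rcases sum_le_adjCount_or_split (G := G) (adjInd_le_one (G := G) v) M with h |
    ⟨L₁, a, L₂, rfl, ha, hc, hs⟩
  · omega
  have hnd1 : (v :: (L₁ ++ a :: L₂)).Nodup := List.nodup_cons.2 ⟨hv, hR⟩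
  have hins := hG ((L₁ ++ [a]) ++ ([v] ++ L₂)) ((List.Perm.nodup_iff (by
    simpa using (List.perm_middle (a := v) (l₁ := L₁ ++ [a]) (l₂ := L₂)))).2 hnd1)
  rw [adjCount_join (a := a) (b := v) (by simp) (by simp), adjInd_comm, ha] at hins
  have h4 := le_adjCount_append (G := G) [v] L₂
  rw [adjCount_singleton] at h4
  simp only [List.map_append, List.map_cons, List.sum_append, List.sum_cons, ha] at hsum
  rcases sum_le_adjCount_or_split (G := G) (adjInd_le_one (G := G) v) L₂ with h |
    ⟨M₁, b, M₂, rfl, hb, hc', hs'⟩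
  · omega
  have h5 := hG ((L₁ ++ [a]) ++ ([v] ++ ((M₁ ++ [b]).reverse ++ M₂))) ((List.Perm.nodup_iff (by
    refine List.Perm.trans ?_ (show (v :: ((L₁ ++ [a]) ++ ((M₁ ++ [b]) ++ M₂))).Perm _ by simp)
    refine List.Perm.trans (List.perm_middle (a := v)) (List.Perm.cons _ ?_)
    exact ((List.reverse_perm _).append_right _).append_left _)).2 hnd1)
  rw [adjCount_join (a := a) (b := v) (by simp) (by simp), adjInd_comm, ha,
    adjCount_join (L := [v]) (M := (M₁ ++ [b]).reverse ++ M₂) (a := v) (b := b) rfl (by simp), hb,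
    adjCount_singleton] at h5
  have h6 := le_adjCount_append (G := G) (M₁ ++ [b]).reverse M₂
  rw [adjCount_reverse] at h6
  omega

end Closure

section Stars

variable {V : Type*} [Fintype V] {G : SimpleGraph V} {t : ℕ}

/-- A graph whose components are stars with at most three leaves has a linear forest with at
least half as many edges as there are vertices. -/
lemma exists_list_of_stars (hdeg : ∀ v, (nbrs G v).card ≤ 3)
    (hstar : ∀ a b, G.Adj a b → (∀ c, G.Adj a c → c = b) ∨ ∀ c, G.Adj b c → c = a)
    (S : Finset V) : (∀ v ∈ S, (∃ u, G.Adj v u) ∧ ∀ u, G.Adj v u → u ∈ S) →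
      ∃ L : List V, L.Nodup ∧ (∀ x ∈ L, x ∈ S) ∧ S.card ≤ 2 * adjCount G L := by
  induction S using Finset.strongInduction with
  | H S ih =>
  intro hS
  rcases S.eq_empty_or_nonempty with rfl | ⟨v, hv⟩
  · exact ⟨[], by simp⟩
  obtain ⟨x, hx, hxl⟩ : ∃ x ∈ S, ∀ c, G.Adj x c → ∀ e, G.Adj c e → e = x := by
    by_cases h : ∀ c, G.Adj v c → ∀ e, G.Adj c e → e = v
    · exact ⟨v, hv, h⟩
    push Not at h
    obtain ⟨c, hvc, e, hce, hev⟩ := h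
    refine ⟨c, (hS v hv).2 c hvc, fun d hcd e' hde => ?_⟩
    rcases hstar c d hcd with h | h
    · exact absurd ((h e hce).trans (h v hvc.symm).symm) hev
    · exact h e' hde
  have hsub : insert x (nbrs G x) ⊆ S := by
    intro y hy
    rcases Finset.mem_insert.1 hy with rfl | hy
    · exact hx
    · exact (hS x hx).2 y (mem_nbrs.1 hy)
  obtain ⟨M, hM, hMS, hMc⟩ := ih (S \ insert x (nbrs G x))
    (Finset.sdiff_ssubset hsub (Finset.insert_nonempty _ _)) (by
      intro v hv
      simp only [Finset.mem_sdiff, Finset.mem_insert, mem_nbrs, not_or] at hv ⊢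
      refine ⟨(hS v hv.1).1, fun u hvu => ⟨(hS v hv.1).2 u hvu, ?_, fun hxu => ?_⟩⟩
      · rintro rfl
        exact hv.2.2 hvu.symm
      · exact hv.2.1 (hxl u hxu v hvu.symm))
  have hcard := Finset.card_sdiff_add_card_eq_card hsub
  rw [Finset.card_insert_of_notMem (by simp [mem_nbrs])] at hcard
  have hM' : ∀ y ∈ insert x (nbrs G x), y ∉ M := fun y hy hyM =>
    (Finset.mem_sdiff.1 (hMS y hyM)).2 hy
  have hMS' : ∀ y ∈ M, y ∈ S := fun y hy => (Finset.mem_sdiff.1 (hMS y hy)).1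
  obtain ⟨y, hxy⟩ := (hS x hx).1
  have hyS := (hS x hx).2 y hxy
  have hyM := hM' y (by simp [mem_nbrs, hxy])
  have hxM := hM' x (by simp)
  by_cases hz : ∃ z, G.Adj x z ∧ z ≠ y
  · obtain ⟨z, hxz, hzy⟩ := hz
    have hzM := hM' z (by simp [mem_nbrs, hxz])
    refine ⟨[y, x, z] ++ M, ?_, ?_, ?_⟩
    · simp [hM, hyM, hxM, hzM, hxy.ne', hxz.ne, hzy.symm]
    · simpa [hyS, hx, (hS x hx).2 z hxz] using hMS'
    · have := le_adjCount_append (G := G) [y, x, z] M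
      simp only [adjCount_cons_cons, adjInd_of_adj hxy.symm, adjInd_of_adj hxz,
        adjCount_singleton] at this
      have := hdeg x
      omega
  · push Not at hz
    have h1 : (nbrs G x).card ≤ 1 := Finset.card_le_one.2 fun a ha b hb =>
      (hz a (mem_nbrs.1 ha)).trans (hz b (mem_nbrs.1 hb)).symm
    refine ⟨[y, x] ++ M, ?_, ?_, ?_⟩
    · simp [hM, hyM, hxM, hxy.ne']
    · simpa [hyS, hx] using hMS'
    · have := le_adjCount_append (G := G) [y, x] M
      simp only [adjCount_cons_cons, adjInd_of_adj hxy.symm, adjCount_singleton] at this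
      omega

/-- If every vertex of `S` can be assigned a neighbour so that no vertex is used more than twice,
then there is a linear forest with at least `|S| / 2` edges. -/
lemma exists_list_of_assignment {S : Finset V} (hS : ∀ v u, G.Adj v u → v ∈ S) {f : V → V}
    (hf : ∀ v ∈ S, G.Adj v (f v)) (hfib : ∀ x, (S.filter (f · = x)).card ≤ 2) :
    ∃ L : List V, L.Nodup ∧ S.card ≤ 2 * adjCount G L := by
  let K₀ : SimpleGraph V := SimpleGraph.fromRel fun a b => a ∈ S ∧ b = f a
  have hK₀G : K₀ ≤ G := by
    rintro a b ⟨-, ⟨ha, rfl⟩ | ⟨hb, rfl⟩⟩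
    · exact hf a ha
    · exact (hf b hb).symm
  have hK₀deg : ∀ v, (nbrs K₀ v).card ≤ 3 := by
    intro v
    have : nbrs K₀ v ⊆ insert (f v) (S.filter (f · = v)) := by
      intro u hu
      obtain ⟨-, ⟨ha, rfl⟩ | ⟨hb, rfl⟩⟩ := mem_nbrs.1 hu
      · simp
      · simp [hb]
    refine (Finset.card_le_card this).trans ((Finset.card_insert_le _ _).trans ?_)
    have := hfib v
    omega
  obtain ⟨K, hKK₀, hK⟩ := (Set.toFinite
    {K : SimpleGraph V | ∀ v ∈ S, ∃ u, K.Adj v u}).exists_le_minimal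
      (a := K₀) (fun v hv => ⟨f v, (hf v hv).ne, Or.inl ⟨hv, rfl⟩⟩)
  obtain ⟨L, hL, -, hc⟩ := exists_list_of_stars (G := K)
    (fun v => (Finset.card_le_card fun u hu => mem_nbrs.2 (hKK₀ (mem_nbrs.1 hu))).trans (hK₀deg v))
    (by
      intro a b hab
      by_contra! hcon
      obtain ⟨⟨c, hac, hcb⟩, e, hbe, hea⟩ := hcon
      have hle := hK.2 (y := K.deleteEdges {s(a, b)}) (by
        intro v hv
        by_cases hva : v = a
        · subst hva
          exact ⟨c, by simp [SimpleGraph.deleteEdges_adj, hac, hcb, hab.ne]⟩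
        by_cases hvb : v = b
        · subst hvb
          exact ⟨e, by simp [SimpleGraph.deleteEdges_adj, hbe, hea, hab.ne']⟩
        obtain ⟨u, hu⟩ := hK.1 v hv
        exact ⟨u, by simp [SimpleGraph.deleteEdges_adj, hu, hva, hvb]⟩)
        (SimpleGraph.deleteEdges_le _)
      simpa [SimpleGraph.deleteEdges_adj] using hle hab) S
    (fun v hv => ⟨hK.1 v hv, fun u hu => hS u v (hK₀G (hKK₀ hu.symm))⟩)
  exact ⟨L, hL, hc.trans (Nat.mul_le_mul_left 2 (adjCount_mono (hKK₀.trans hK₀G) L))⟩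

lemma exists_assignment {S : Finset V}
    (h : ∀ T ⊆ S, T.card ≤ 2 * (T.biUnion (nbrs G)).card) :
    ∃ f : V → V, (∀ v ∈ S, G.Adj v (f v)) ∧ ∀ x, (S.filter (f · = x)).card ≤ 2 := by
  obtain ⟨g, hg, hgm⟩ := (Finset.all_card_le_biUnion_card_iff_exists_injective
    (fun v : S => nbrs G v ×ˢ (Finset.univ : Finset (Fin 2)))).1 (by
      intro T
      have h1 := h (T.map (Function.Embedding.subtype _)) (by
        intro x hx
        obtain ⟨y, -, rfl⟩ := Finset.mem_map.1 hx
        exact y.2)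
      rw [Finset.card_map] at h1
      refine h1.trans (le_of_eq ?_)
      have h2 : (T.biUnion fun v : S => nbrs G v ×ˢ (Finset.univ : Finset (Fin 2))) =
          (T.map (Function.Embedding.subtype _)).biUnion (nbrs G) ×ˢ Finset.univ := by
        ext ⟨a, b⟩
        simp only [Finset.mem_biUnion, Finset.mem_product, Finset.mem_univ, and_true,
          Finset.mem_map, Function.Embedding.subtype_apply]
        constructor
        · rintro ⟨v, hv, ha⟩
          exact ⟨v, ⟨v, hv, rfl⟩, ha⟩
        · rintro ⟨_, ⟨v, hv, rfl⟩, ha⟩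
          exact ⟨v, hv, ha⟩
      rw [h2, Finset.card_product, Finset.card_univ, Fintype.card_fin, mul_comm])
  have hg1 : ∀ v (hv : v ∈ S), G.Adj v (g ⟨v, hv⟩).1 := fun v hv =>
    mem_nbrs.1 (Finset.mem_product.1 (hgm ⟨v, hv⟩)).1
  refine ⟨fun v => if hv : v ∈ S then (g ⟨v, hv⟩).1 else v,
    fun v hv => by simpa [hv] using hg1 v hv,
    fun x => ?_⟩
  have h2 : (Finset.univ : Finset (Fin 2)).card = 2 := by simp
  refine (Finset.card_le_card_of_injOn (t := (Finset.univ : Finset (Fin 2)))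
    (fun v => if hv : v ∈ S then (g ⟨v, hv⟩).2 else 0)
    (fun _ _ => Finset.mem_coe.2 (Finset.mem_univ _)) ?_).trans h2.le
  intro a ha b hb hab
  simp only [Finset.coe_filter, Set.mem_ofPred_eq] at ha hb
  obtain ⟨ha, ha'⟩ := ha
  obtain ⟨hb, hb'⟩ := hb
  simp only [ha, hb, dif_pos] at ha' hb' hab
  simpa using hg (Prod.ext (ha'.trans hb'.symm) hab)

lemma exists_two_stars {X T : Finset V}
    (h : ∀ Y ⊆ X, 2 * Y.card ≤ (T ∩ Y.biUnion (nbrs G)).card) :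
    ∃ g : V → Fin 2 → V, (∀ x ∈ X, ∀ i, g x i ∈ T ∧ G.Adj x (g x i)) ∧
      ∀ x ∈ X, ∀ y ∈ X, ∀ i j, g x i = g y j → x = y ∧ i = j := by
  obtain ⟨g, hg, hgm⟩ := (Finset.all_card_le_biUnion_card_iff_exists_injective
    (fun p : X × Fin 2 => T ∩ nbrs G p.1)).1 (by
      intro Z
      have h1 := h (Z.image fun p => (p.1 : V)) (by
        intro x hx
        obtain ⟨y, -, rfl⟩ := Finset.mem_image.1 hx
        exact y.1.2)
      have h2 : Z.card ≤ (((Z.image fun p => (p.1 : V)) ×ˢ (Finset.univ : Finset (Fin 2)))).card :=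
        Finset.card_le_card_of_injOn (fun p => ((p.1 : V), p.2))
          (fun p hp => by
            have hp : p ∈ Z := hp
            simp only [Finset.coe_product, Set.mem_prod, Finset.mem_coe, Finset.mem_univ, and_true]
            exact Finset.mem_image_of_mem _ hp)
          (fun p _ q _ hpq => by
            simp only [Prod.mk.injEq] at hpq
            exact Prod.ext (Subtype.ext hpq.1) hpq.2)
      rw [Finset.card_product, Finset.card_univ, Fintype.card_fin, mul_comm] at h2
      refine h2.trans (h1.trans (Finset.card_le_card ?_))
      intro a ha
      simp only [Finset.mem_inter, Finset.mem_biUnion, Finset.mem_image] at ha ⊢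
      obtain ⟨ha, _, ⟨p, hp, rfl⟩, hpa⟩ := ha
      exact ⟨p, hp, ha, hpa⟩)
  refine ⟨fun x i => if hx : x ∈ X then g (⟨x, hx⟩, i) else x, ?_, ?_⟩
  · intro x hx i
    have := Finset.mem_inter.1 (hgm (⟨x, hx⟩, i))
    simpa [hx, mem_nbrs] using this
  · intro x hx y hy i j hxy
    simp only [hx, hy, dif_pos] at hxy
    simpa using hg hxy

omit [Fintype V] in
lemma exists_list_of_two_stars {X T : Finset V} (hXT : Disjoint X T) {g : V → Fin 2 → V}
    (hg : ∀ x ∈ X, ∀ i, g x i ∈ T ∧ G.Adj x (g x i))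
    (hinj : ∀ x ∈ X, ∀ y ∈ X, ∀ i j, g x i = g y j → x = y ∧ i = j) :
    ∃ L : List V, L.Nodup ∧ (∀ x ∈ L, x ∈ X ∨ x ∈ T) ∧ 2 * X.card ≤ adjCount G L := by
  suffices h : ∀ Y ⊆ X, ∃ L : List V, L.Nodup ∧ (∀ x ∈ L, x ∈ Y ∨ ∃ y ∈ Y, ∃ i, x = g y i) ∧
      2 * Y.card ≤ adjCount G L by
    obtain ⟨L, h1, h2, h3⟩ := h X subset_rfl
    refine ⟨L, h1, fun x hx => ?_, h3⟩
    rcases h2 x hx with h | ⟨y, hy, i, rfl⟩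
    · exact Or.inl h
    · exact Or.inr (hg y hy i).1
  intro Y
  induction Y using Finset.induction_on with
  | empty => exact fun _ => ⟨[], by simp⟩
  | insert x Y hxY ih =>
    intro hY
    have hx : x ∈ X := hY (Finset.mem_insert_self _ _)
    have hYX : Y ⊆ X := (Finset.subset_insert _ _).trans hY
    obtain ⟨L, h1, h2, h3⟩ := ih hYX
    have hxL : x ∉ L := by
      intro h
      rcases h2 x h with h | ⟨y, hy, i, e⟩
      · exact hxY h
      · exact Finset.disjoint_left.1 hXT hx (e ▸ (hg y (hYX hy) i).1)
    have hgL : ∀ i, g x i ∉ L := by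
      intro i h
      rcases h2 _ h with h | ⟨y, hy, j, e⟩
      · exact Finset.disjoint_left.1 hXT (hYX h) (hg x hx i).1
      · exact hxY ((hinj x hx y (hYX hy) i j e).1 ▸ hy)
    have h01 : g x 0 ≠ g x 1 := fun h => by simpa using (hinj x hx x hx 0 1 h).2
    refine ⟨[g x 0, x, g x 1] ++ L, ?_, ?_, ?_⟩
    · simp [h1, hxL, hgL, h01, (hg x hx 0).2.ne', (hg x hx 1).2.ne]
    · intro z hz
      simp only [List.mem_append, List.mem_cons, List.not_mem_nil, or_false] at hz
      rcases hz with (rfl | rfl | rfl) | hz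
      · exact Or.inr ⟨x, by simp, 0, rfl⟩
      · simp
      · exact Or.inr ⟨x, by simp, 1, rfl⟩
      · rcases h2 z hz with h | ⟨y, hy, i, e⟩
        · simp [h]
        · exact Or.inr ⟨y, by simp [hy], i, e⟩
    · have := le_adjCount_append (G := G) [g x 0, x, g x 1] L
      simp only [adjCount_cons_cons, adjInd_of_adj (hg x hx 0).2.symm,
        adjInd_of_adj (hg x hx 1).2, adjCount_singleton] at this
      rw [Finset.card_insert_of_notMem hxY]
      omega

/-- No nonempty set of vertices can be deleted at a loss of two edges per vertex. -/
def Irreducible (G : SimpleGraph V) (t : ℕ) : Prop :=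
  ∀ X : Finset V, X.Nonempty →
    ∃ L : List V, L.Nodup ∧ t + 1 ≤ adjCount (isolate G X) L + 2 * X.card

lemma card_le_two_mul_card_biUnion (hG : LinearForestBound G t) (hirr : Irreducible G t)
    (T : Finset V) : (∀ v ∈ T, ∃ u, G.Adj v u) → T.card ≤ 2 * (T.biUnion (nbrs G)).card := by
  induction T using Finset.strongInduction with
  | H T ih =>
  intro hT
  by_contra! hlt
  have hdisj : T ∩ T.biUnion (nbrs G) = ∅ := by
    by_contra hne
    have hss : T \ T.biUnion (nbrs G) ⊂ T := by
      rw [← Finset.sdiff_inter_self_left]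
      exact Finset.sdiff_ssubset Finset.inter_subset_left (Finset.nonempty_iff_ne_empty.2 hne)
    have h1 := ih _ hss fun v hv => hT v (hss.1 hv)
    have h2 : Disjoint (T ∩ T.biUnion (nbrs G)) ((T \ T.biUnion (nbrs G)).biUnion (nbrs G)) := by
      rw [Finset.disjoint_left]
      intro z hz hz'
      simp only [Finset.mem_biUnion, Finset.mem_sdiff, mem_nbrs] at hz'
      obtain ⟨w, ⟨-, hw⟩, hwz⟩ := hz'
      exact hw ⟨z, (Finset.mem_inter.1 hz).1, hwz.symm⟩
    have h3 := Finset.card_union_of_disjoint h2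
    have h4 : (T ∩ T.biUnion (nbrs G)) ∪ (T \ T.biUnion (nbrs G)).biUnion (nbrs G) ⊆
        T.biUnion (nbrs G) :=
      Finset.union_subset Finset.inter_subset_right
        (Finset.biUnion_subset_biUnion_of_subset_left _ hss.1)
    have h5 := Finset.card_le_card h4
    have h6 := Finset.card_sdiff_add_card_inter T (T.biUnion (nbrs G))
    omega
  have hne : T.Nonempty := Finset.card_pos.1 (by omega)
  obtain ⟨v, hv⟩ := hne
  obtain ⟨u, hu⟩ := hT v hv
  obtain ⟨L, hL, hLt⟩ := hirr (T.biUnion (nbrs G))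
    ⟨u, Finset.mem_biUnion.2 ⟨v, hv, mem_nbrs.2 hu⟩⟩
  obtain ⟨g, hg, hinj⟩ := exists_two_stars (G := G) (X := T.biUnion (nbrs G)) (T := T) (by
    intro Y hY
    rcases Y.eq_empty_or_nonempty with rfl | ⟨y, hy⟩
    · simp
    have hss : T \ Y.biUnion (nbrs G) ⊂ T := by
      rw [← Finset.sdiff_inter_self_left]
      refine Finset.sdiff_ssubset Finset.inter_subset_left ?_
      obtain ⟨w, hw, hwy⟩ := Finset.mem_biUnion.1 (hY hy)
      exact ⟨w, Finset.mem_inter.2 ⟨hw, Finset.mem_biUnion.2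
        ⟨y, hy, mem_nbrs.2 (mem_nbrs.1 hwy).symm⟩⟩⟩
    have h1 := ih _ hss fun v hv => hT v (hss.1 hv)
    have h2 : (T \ Y.biUnion (nbrs G)).biUnion (nbrs G) ⊆ T.biUnion (nbrs G) \ Y := by
      intro z hz
      simp only [Finset.mem_biUnion, Finset.mem_sdiff, mem_nbrs] at hz ⊢
      obtain ⟨w, ⟨hw, hw'⟩, hwz⟩ := hz
      exact ⟨⟨w, hw, hwz⟩, fun hzY => hw' ⟨z, hzY, hwz.symm⟩⟩
    have h3 := Finset.card_le_card h2
    have h4 := Finset.card_sdiff_add_card_eq_card hY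
    have h5 := Finset.card_sdiff_add_card_inter T (Y.biUnion (nbrs G))
    omega)
  have hdisj' : Disjoint (T.biUnion (nbrs G)) T := by
    rw [disjoint_comm, Finset.disjoint_iff_inter_eq_empty]
    exact hdisj
  obtain ⟨M, hM, hMm, hMc⟩ := exists_list_of_two_stars hdisj' hg hinj
  obtain ⟨L', hL', hLm, hLc⟩ := exists_restrict (G := isolate G (T.biUnion (nbrs G)))
    (p := fun x => x ∉ T.biUnion (nbrs G) ∧ x ∉ T)
    (fun a b h => ⟨h.2.1, fun ha => h.2.2 (Finset.mem_biUnion.2 ⟨a, ha, mem_nbrs.2 h.1⟩)⟩) hL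
  have h1 := hG (M ++ L') (List.nodup_append.2 ⟨hM, hL', by
    rintro a ha b hb rfl
    rcases hMm a ha with h | h
    · exact (hLm a hb).1 h
    · exact (hLm a hb).2 h⟩)
  have h2 := le_adjCount_append (G := G) M L'
  have h3 := adjCount_mono (isolate_le G (T.biUnion (nbrs G))) L'
  omega

/-- An irreducible graph has at most `2t` vertices which are not isolated. -/
lemma card_support_le (hG : LinearForestBound G t) (hirr : Irreducible G t) :
    (Finset.univ.filter fun v => ∃ u, G.Adj v u).card ≤ 2 * t := by
  obtain ⟨f, hf, hfib⟩ := exists_assignment (G := G)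
    (S := Finset.univ.filter fun v => ∃ u, G.Adj v u)
    (fun T hT => card_le_two_mul_card_biUnion hG hirr T fun v hv => by simpa using hT hv)
  obtain ⟨L, hL, hc⟩ := exists_list_of_assignment (fun v u h => by simpa using ⟨u, h⟩) hf hfib
  exact hc.trans (Nat.mul_le_mul_left 2 (hG L hL))

end Stars

section Cliques

variable {V : Type*} [Fintype V] {G : SimpleGraph V} {t : ℕ}

lemma choose_add_choose_le (x i : ℕ) : ∀ y : ℕ,
    x.choose (i + 1) + y.choose (i + 1) ≤ (x + y).choose (i + 1)
  | 0 => by simp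
  | y + 1 => by
    have h1 := choose_add_choose_le x i y
    have h2 : y.choose i ≤ (x + y).choose i := Nat.choose_le_choose i (by omega)
    rw [← add_assoc, Nat.choose_succ_succ' y, Nat.choose_succ_succ' (x + y)]
    omega

/-- The finset of cliques with `j` vertices. -/
noncomputable def cliques (G : SimpleGraph V) (j : ℕ) : Finset (Finset V) :=
  Finset.univ.filter (G.IsNClique j)

lemma mem_cliques {j : ℕ} {s : Finset V} : s ∈ cliques G j ↔ G.IsNClique j s := by
  simp [cliques]

lemma cliques_mono {H : SimpleGraph V} (h : G ≤ H) (j : ℕ) : cliques G j ⊆ cliques H j :=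
  fun _ hs => mem_cliques.2 ((mem_cliques.1 hs).mono h)

lemma card_cliques_mem_le (v : V) (i : ℕ) :
    ((cliques G (i + 1)).filter (v ∈ ·)).card ≤ (nbrs G v).card.choose i := by
  rw [← Finset.card_powersetCard]
  refine Finset.card_le_card_of_injOn (fun s => s.erase v) ?_ ?_
  · intro s hs
    simp only [Finset.coe_filter, mem_cliques, Set.mem_ofPred_eq] at hs
    simp only [Finset.mem_coe, Finset.mem_powersetCard]
    refine ⟨fun u hu => ?_, by rw [Finset.card_erase_of_mem hs.2, hs.1.card_eq]; rfl⟩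
    obtain ⟨huv, hu⟩ := Finset.mem_erase.1 hu
    exact mem_nbrs.2 (hs.1.isClique hs.2 hu huv.symm)
  · intro s hs s' hs' h
    simp only [Finset.coe_filter, Set.mem_ofPred_eq] at hs hs'
    rw [← Finset.insert_erase hs.2, ← Finset.insert_erase hs'.2]
    exact congrArg _ h

lemma mul_card_cliques_le (i : ℕ) :
    (i + 1) * (cliques G (i + 1)).card ≤ ∑ v, (nbrs G v).card.choose i := by
  calc (i + 1) * (cliques G (i + 1)).card = ∑ s ∈ cliques G (i + 1), s.card := by
        rw [Finset.sum_congr rfl fun s hs => (mem_cliques.1 hs).card_eq, Finset.sum_const,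
          smul_eq_mul, mul_comm]
    _ = ∑ s ∈ cliques G (i + 1), ∑ v, if v ∈ s then 1 else 0 := by simp
    _ = ∑ v, ((cliques G (i + 1)).filter (v ∈ ·)).card := by
        rw [Finset.sum_comm]
        simp
    _ ≤ _ := Finset.sum_le_sum fun v _ => card_cliques_mem_le v i

lemma sum_choose_degree_le {i : ℕ} (hdeg : ∀ v, (nbrs G v).card ≤ t)
    (hsupp : (Finset.univ.filter fun v => ∃ u, G.Adj v u).card ≤ 2 * t)
    (hclosed : ∀ u v, u ≠ v → ¬ G.Adj u v → (nbrs G u).card + (nbrs G v).card ≤ t) :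
    ∑ v, (nbrs G v).card.choose (i + 1) ≤ (t + 1) * t.choose (i + 1) := by
  set S := Finset.univ.filter fun v => ∃ u, G.Adj v u with hS
  have hsum : ∑ v, (nbrs G v).card.choose (i + 1) = ∑ v ∈ S, (nbrs G v).card.choose (i + 1) := by
    refine (Finset.sum_subset (Finset.subset_univ S) fun v _ hv => ?_).symm
    have : nbrs G v = ∅ := Finset.eq_empty_of_forall_notMem fun u hu =>
      hv (Finset.mem_filter.2 ⟨Finset.mem_univ _, u, mem_nbrs.1 hu⟩)
    simp [this]
  rw [hsum]
  rcases S.eq_empty_or_nonempty with h0 | hne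
  · simp [h0]
  obtain ⟨x, hxS, hx⟩ := S.exists_max_image (fun v => (nbrs G v).card) hne
  set D := (nbrs G x).card with hD
  by_cases h2 : t ≤ 2 * D
  · obtain ⟨e, he⟩ : ∃ e, t = D + e := Nat.exists_eq_add_of_le (hdeg x)
    have hN : insert x (nbrs G x) ⊆ S := by
      intro u hu
      rcases Finset.mem_insert.1 hu with rfl | hu
      · exact hxS
      · exact Finset.mem_filter.2 ⟨Finset.mem_univ _, x, (mem_nbrs.1 hu).symm⟩
    have hcN : (insert x (nbrs G x)).card = D + 1 :=
      Finset.card_insert_of_notMem fun h => (mem_nbrs.1 h).ne rfl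
    rw [← Finset.sum_sdiff hN]
    have h3 : ∑ v ∈ insert x (nbrs G x), (nbrs G v).card.choose (i + 1) ≤
        (D + 1) * D.choose (i + 1) := by
      rw [← hcN, ← smul_eq_mul]
      exact Finset.sum_le_card_nsmul _ _ _ fun v hv => Nat.choose_le_choose _ (hx v (hN hv))
    have h4 : ∑ v ∈ S \ insert x (nbrs G x), (nbrs G v).card.choose (i + 1) ≤
        (D + 2 * e) * e.choose (i + 1) := by
      refine (Finset.sum_le_card_nsmul _ _ (e.choose (i + 1)) fun v hv => ?_).trans ?_
      · obtain ⟨-, hv⟩ := Finset.mem_sdiff.1 hv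
        rw [Finset.mem_insert, mem_nbrs, not_or] at hv
        have := hclosed x v (Ne.symm hv.1) hv.2
        exact Nat.choose_le_choose _ (by omega)
      · rw [smul_eq_mul]
        refine Nat.mul_le_mul_right _ ?_
        rw [Finset.card_sdiff_of_subset hN, hcN]
        omega
    have h5 : e.choose (i + 1) ≤ D.choose (i + 1) := Nat.choose_le_choose _ (by omega)
    have h6 := choose_add_choose_le D i e
    rw [he]
    nlinarith [Nat.mul_le_mul_left (D + e + 1) h6, Nat.mul_le_mul_left e h5]
  · have h3 : ∑ v ∈ S, (nbrs G v).card.choose (i + 1) ≤ 2 * t * D.choose (i + 1) := by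
      refine (Finset.sum_le_card_nsmul _ _ (D.choose (i + 1)) fun v hv =>
        Nat.choose_le_choose _ (hx v hv)).trans ?_
      exact Nat.mul_le_mul_right _ hsupp
    have h4 := choose_add_choose_le D i D
    have h5 : (D + D).choose (i + 1) ≤ t.choose (i + 1) := Nat.choose_le_choose _ (by omega)
    nlinarith [Nat.mul_le_mul_left (t + 1) (h4.trans h5)]

omit [Fintype V] in
lemma Irreducible.mono {H : SimpleGraph V} (h : Irreducible G t) (hGH : G ≤ H) :
    Irreducible H t := by
  intro X hX
  obtain ⟨L, hL, hc⟩ := h X hX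
  exact ⟨L, hL, hc.trans (Nat.add_le_add_right (adjCount_mono (isolate_mono hGH X) L) _)⟩

lemma card_cliques_le (hG : LinearForestBound G t) (hirr : Irreducible G t) (i : ℕ) :
    (cliques G (i + 2)).card ≤ (t + 1).choose (i + 2) := by
  obtain ⟨H, hGH, hH, hclosed⟩ := exists_closed hG
  have hirr := hirr.mono hGH
  refine (Finset.card_le_card (cliques_mono hGH _)).trans ?_
  have h1 := (mul_card_cliques_le (G := H) (i + 1)).trans <|
    sum_choose_degree_le (fun v => by
      obtain ⟨L, hL, hc⟩ := hirr {v} (Finset.singleton_nonempty v)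
      exact card_nbrs_le hH hL (by simpa using hc)) (card_support_le hH hirr) hclosed
  rw [Nat.add_one_mul_choose_eq, mul_comm] at h1
  exact Nat.le_of_mul_le_mul_right h1 (by omega)

end Cliques

section Reduction

variable {V : Type*} [Fintype V] {G : SimpleGraph V} {t : ℕ}

lemma exists_linearForest : ∀ (a : V) (l : List V), (a :: l).Nodup → ∃ H ≤ G, H.IsAcyclic ∧
    (∀ v, degN H v ≤ 2) ∧ degN H a ≤ 1 ∧ (∀ v ∉ a :: l, ∀ u, ¬ H.Adj v u) ∧
    H.edgeSet.ncard = adjCount G (a :: l)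
  | a, [], _ => by
    refine ⟨⊥, bot_le, SimpleGraph.isAcyclic_bot, ?_, ?_, ?_, ?_⟩ <;> simp [degN]
  | a, b :: l, h => by
    obtain ⟨ha, hl⟩ := List.nodup_cons.1 h
    have hab : a ≠ b := fun e => ha (e ▸ List.mem_cons_self)
    obtain ⟨H, hHG, hac, hdeg, hb, hiso, hcard⟩ := exists_linearForest b l hl
    have hHa := hiso a ha
    by_cases hadj : G.Adj a b
    · have hnr : ¬ H.Reachable a b := by
        rintro ⟨w⟩
        cases w with
        | nil => exact hab rfl
        | cons h' _ => exact hHa _ h'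
      have hnadj : ¬ H.Adj a b := hHa b
      have hN : ∀ v, (H ⊔ edge a b).neighborSet v ⊆
          H.neighborSet v ∪ (if v = a then {b} else if v = b then {a} else ∅) := by
        intro v u hu
        simp only [SimpleGraph.mem_neighborSet, SimpleGraph.sup_adj, SimpleGraph.edge_adj] at hu
        rcases hu with hu | ⟨⟨rfl, rfl⟩ | ⟨rfl, rfl⟩, -⟩
        · exact Or.inl hu
        · right; simp
        · right; simp [hab.symm]
      have hNa : H.neighborSet a = ∅ := Set.eq_empty_iff_forall_notMem.2 fun u hu => hHa u hu
      have hdega : degN (H ⊔ edge a b) a ≤ 1 := by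
        refine (Set.ncard_le_ncard (hN a) (Set.toFinite _)).trans ?_
        simp [hNa]
      refine ⟨H ⊔ edge a b, sup_le hHG ((SimpleGraph.edge_le_iff G).2 (Or.inr hadj)),
        hac.sup_edge_of_not_reachable hnr, fun v => ?_, hdega, fun v hv u huv => ?_, ?_⟩
      · by_cases hva : v = a
        · subst hva
          omega
        refine (Set.ncard_le_ncard (hN v) (Set.toFinite _)).trans ?_
        refine (Set.ncard_union_le _ _).trans ?_
        have h2 := hdeg v
        unfold degN at h2 hb
        by_cases hvb : v = b
        · subst hvb
          rw [if_neg hva, if_pos rfl, Set.ncard_singleton]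
          omega
        · simpa [hva, hvb] using h2
      · simp only [List.mem_cons, not_or] at hv
        rw [SimpleGraph.sup_adj, SimpleGraph.edge_adj] at huv
        rcases huv with huv | ⟨⟨rfl, -⟩ | ⟨rfl, -⟩, -⟩
        · exact hiso v (by simp [hv.2.1, hv.2.2]) u huv
        · exact hv.1 rfl
        · exact hv.2.1 rfl
      · rw [SimpleGraph.edgeSet_sup, SimpleGraph.edgeSet_edge_of_ne hab, Set.union_singleton,
          Set.ncard_insert_of_notMem (by simpa using hnadj) (Set.toFinite _), hcard,
          adjCount_cons_cons, adjInd_of_adj hadj, add_comm]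
    · refine ⟨H, hHG, hac, hdeg, ?_, fun v hv => hiso v fun h => hv (List.mem_cons_of_mem _ h), ?_⟩
      · unfold degN
        rw [show H.neighborSet a = ∅ from Set.eq_empty_iff_forall_notMem.2 fun u hu => hHa u hu]
        simp
      · rw [hcard, adjCount_cons_cons, adjInd_of_not_adj hadj, zero_add]

omit [Fintype V] in
lemma exists_suffix_adjCount_eq {k : ℕ} : ∀ L : List V, k ≤ adjCount G L →
    ∃ M, M <:+ L ∧ adjCount G M = k
  | [], h => ⟨[], List.suffix_rfl, by simp at h ⊢; omega⟩
  | a :: l, h => by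
    rcases h.eq_or_lt with h | h
    · exact ⟨a :: l, List.suffix_rfl, h.symm⟩
    · have h1 : adjCount G (a :: l) ≤ 1 + adjCount G l := by
        cases l with
        | nil => simp
        | cons b l =>
          have := adjInd_le_one (G := G) a b
          rw [adjCount_cons_cons]
          omega
      have h2 : k ≤ adjCount G l := by omega
      obtain ⟨M, hM, hc⟩ := exists_suffix_adjCount_eq l h2
      exact ⟨M, hM.trans (List.suffix_cons a l), hc⟩

lemma linearForestBound_of_free {k : ℕ} (hk : 0 < k) (hG : LinearForestFree k G) :
    LinearForestBound G (k - 1) := by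
  intro L hL
  by_contra! hlt
  obtain ⟨M, hM, hc⟩ := exists_suffix_adjCount_eq (G := G) (k := k) L (by omega)
  have hMn := hL.sublist hM.sublist
  cases M with
  | nil => simp at hc; omega
  | cons a l =>
    obtain ⟨H, hHG, hac, hdeg, -, -, hcard⟩ := exists_linearForest (G := G) a l hMn
    exact hG H hHG ⟨hac, hdeg⟩ (hcard.trans hc)

lemma exists_irreducible_isolate {k : ℕ} (hG : ∀ L : List V, L.Nodup → adjCount G L < k) :
    ∃ A : Finset V, 2 * A.card < k ∧ LinearForestBound (isolate G A) (k - 1 - 2 * A.card) ∧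
      (A.card < Fintype.card V → Irreducible (isolate G A) (k - 1 - 2 * A.card)) := by
  have h0 : (Finset.univ.filter fun A : Finset V =>
      ∀ L : List V, L.Nodup → adjCount (isolate G A) L + 2 * A.card < k).Nonempty :=
    ⟨∅, by
      simp only [Finset.mem_filter, Finset.mem_univ, true_and, Finset.card_empty]
      exact fun L hL => (adjCount_mono (isolate_le G ∅) L).trans_lt (hG L hL)⟩
  obtain ⟨A, hA, hmax⟩ := Finset.exists_max_image _ Finset.card h0
  have hA := (Finset.mem_filter.1 hA).2
  have hA0 : 2 * A.card < k := by simpa using hA [] List.nodup_nil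
  refine ⟨A, hA0, fun L hL => by have := hA L hL; omega, fun hlt X hX => ?_⟩
  have key : ∀ Y : Finset V, Y.Nonempty → Disjoint A Y → ∃ L : List V, L.Nodup ∧
      k ≤ adjCount (isolate (isolate G A) Y) L + 2 * (A.card + Y.card) := by
    intro Y hY hd
    by_contra! hcon
    have h1 := hmax (A ∪ Y) (Finset.mem_filter.2 ⟨Finset.mem_univ _, fun L hL => by
      rw [← isolate_isolate, Finset.card_union_of_disjoint hd]
      exact hcon L hL⟩)
    rw [Finset.card_union_of_disjoint hd] at h1
    have := hY.card_pos
    omega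
  by_cases hXA : X ⊆ A
  · obtain ⟨v, hv⟩ : ∃ v, v ∉ A := by
      by_contra! hcon
      exact hlt.ne ((Finset.card_eq_iff_eq_univ A).2 (Finset.eq_univ_of_forall hcon))
    obtain ⟨L, hL, hc⟩ := key {v} (Finset.singleton_nonempty v) (by simpa using hv)
    have h1 := adjCount_mono (isolate_le (isolate G A) {v}) L
    have h2 : isolate G A = isolate (isolate G A) X := by
      rw [isolate_isolate, Finset.union_eq_left.2 hXA]
    refine ⟨L, hL, ?_⟩
    rw [← h2]
    rw [Finset.card_singleton] at hc
    have := hX.card_pos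
    omega
  · obtain ⟨L, hL, hc⟩ := key (X \ A) (Finset.sdiff_nonempty.2 hXA) Finset.disjoint_sdiff
    refine ⟨L, hL, ?_⟩
    have h3 := Finset.card_le_card (Finset.sdiff_subset (s := X) (t := A))
    rw [isolate_isolate, Finset.union_sdiff_self_eq_union, ← isolate_isolate] at hc
    omega

end Reduction

section Counting

lemma le_max_of_convex {f : ℕ → ℤ} {d a e : ℕ} (hda : d ≤ a) (hae : a ≤ e)
    (hf : ∀ x y, x ≤ y → y < e → f (x + 1) - f x ≤ f (y + 1) - f y) : f a ≤ max (f d) (f e) := by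
  rcases hae.eq_or_lt with rfl | hlt
  · exact le_max_right _ _
  by_cases h : 0 ≤ f (a + 1) - f a
  · refine le_max_of_le_right ?_
    have : ∀ y, a ≤ y → y ≤ e → f a ≤ f y := by
      intro y hy
      induction y, hy using Nat.le_induction with
      | base => simp
      | succ y hy ih =>
        intro hye
        have h1 := ih (by omega)
        have h2 := hf a y hy (by omega)
        omega
    exact this e hae le_rfl
  · refine le_max_of_le_left ?_
    have : ∀ j, j ≤ a → f a ≤ f (a - j) := by
      intro j
      induction j with
      | zero => simp
      | succ j ih =>
        intro hj
        have h1 := ih (by omega)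
        have h2 := hf (a - (j + 1)) a (by omega) hlt
        rw [show a - (j + 1) + 1 = a - j by omega] at h2
        omega
    simpa [Nat.sub_sub_self hda] using this (a - d) (by omega)

lemma hr_succ_sub_hr {p n k a : ℕ} (ha : a < k) :
    hr (p + 2) n k (a + 1) - hr (p + 2) n k a =
      (a + 1).choose (p + 1) + ((n : ℤ) - k + a) * a.choose p - (k - (a + 1)).choose (p + 1) := by
  obtain ⟨b, rfl⟩ := Nat.exists_eq_add_of_lt ha
  simp only [hr, show p + 2 - 1 = p + 1 by omega, show a + b + 1 - (a + 1) = b by omega,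
    show a + b + 1 - a = b + 1 by omega, Nat.choose_succ_succ' b (p + 1),
    Nat.choose_succ_succ' a p]
  push_cast
  ring

lemma hr_le_max {r n k d a e : ℕ} (hr2 : 2 ≤ r) (hkn : k ≤ n) (hda : d ≤ a) (hae : a ≤ e)
    (hek : e ≤ k) : hr r n k a ≤ max (hr r n k d) (hr r n k e) := by
  obtain ⟨p, rfl⟩ := Nat.exists_eq_add_of_le' hr2
  refine le_max_of_convex hda hae fun x y hxy hye => ?_
  rw [hr_succ_sub_hr (by omega), hr_succ_sub_hr (by omega)]
  have h1 : (x + 1).choose (p + 1) ≤ (y + 1).choose (p + 1) := Nat.choose_le_choose _ (by omega)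
  have h2 : x.choose p ≤ y.choose p := Nat.choose_le_choose _ hxy
  have h3 : (k - (y + 1)).choose (p + 1) ≤ (k - (x + 1)).choose (p + 1) :=
    Nat.choose_le_choose _ (by omega)
  have h4 : ((n : ℤ) - k + x) * x.choose p ≤ ((n : ℤ) - k + y) * y.choose p := by
    have : (k : ℤ) ≤ n := by exact_mod_cast hkn
    gcongr
  have h1' : ((x + 1).choose (p + 1) : ℤ) ≤ (y + 1).choose (p + 1) := by exact_mod_cast h1
  have h3' : ((k - (y + 1)).choose (p + 1) : ℤ) ≤ (k - (x + 1)).choose (p + 1) := by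
    exact_mod_cast h3
  linarith

variable {V : Type*} [Fintype V] {G : SimpleGraph V} {t : ℕ}

lemma Nr_eq_card_cliques (r : ℕ) (G : SimpleGraph V) : Nr r G = (cliques G r).card := by
  rw [Nr, ← Set.ncard_coe_finset]
  congr 1
  ext s
  simp [mem_cliques]

lemma card_cliques_le_sum (A : Finset V) (r : ℕ) : (cliques G r).card ≤
    ∑ p ∈ Finset.HasAntidiagonal.antidiagonal r,
      A.card.choose p.1 * ((cliques (isolate G A) p.2).filter (Disjoint A ·)).card := by
  simp_rw [← Finset.card_powersetCard, ← Finset.card_product]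
  refine le_trans ?_ Finset.card_biUnion_le
  refine Finset.card_le_card_of_injOn (fun s => (s ∩ A, s \ A)) ?_ ?_
  · intro s hs
    have hs := mem_cliques.1 hs
    simp only [Finset.coe_biUnion, Set.mem_iUnion, Finset.mem_coe, Finset.mem_product,
      Finset.mem_powersetCard, Finset.mem_filter, mem_cliques, exists_prop]
    refine ⟨((s ∩ A).card, (s \ A).card), ?_, ⟨Finset.inter_subset_right, rfl⟩, ⟨⟨?_, rfl⟩,
      Finset.disjoint_sdiff⟩⟩
    · rw [Finset.HasAntidiagonal.mem_antidiagonal, Finset.card_inter_add_card_sdiff, hs.card_eq]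
    · intro x hx y hy hxy
      simp only [Finset.coe_sdiff, Set.mem_sdiff, Finset.mem_coe] at hx hy
      exact ⟨hs.isClique hx.1 hy.1 hxy, hx.2, hy.2⟩
  · intro s _ s' _ h
    simp only [Prod.mk.injEq] at h
    rw [← Finset.sdiff_union_inter s A, ← Finset.sdiff_union_inter s' A, h.1, h.2]

lemma card_cliques_le_hr {A : Finset V} {r k : ℕ} (hr2 : 2 ≤ r) (hA : 2 * A.card < k)
    (hkn : k ≤ Fintype.card V) (hG : LinearForestBound (isolate G A) (k - 1 - 2 * A.card))
    (hirr : Irreducible (isolate G A) (k - 1 - 2 * A.card)) :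
    ((cliques G r).card : ℤ) ≤ hr r (Fintype.card V) k A.card := by
  set a := A.card with ha
  set x := Fintype.card V - (k - a) with hx
  have hc : ∀ j, ((cliques (isolate G A) j).filter (Disjoint A ·)).card ≤
      (k - 2 * a).choose j + if j = 1 then x else 0 := by
    intro j
    match j with
    | 0 =>
      have : (cliques (isolate G A) 0).filter (Disjoint A ·) ⊆ {∅} := by
        intro s hs
        simpa [mem_cliques] using (mem_cliques.1 (Finset.mem_filter.1 hs).1).card_eq
      simpa using Finset.card_le_card this
    | 1 =>
      have : (cliques (isolate G A) 1).filter (Disjoint A ·) ⊆ Finset.powersetCard 1 Aᶜ := by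
        intro s hs
        obtain ⟨h1, h2⟩ := Finset.mem_filter.1 hs
        exact Finset.mem_powersetCard.2 ⟨fun y hy => Finset.mem_compl.2 fun hyA =>
          Finset.disjoint_left.1 h2 hyA hy, (mem_cliques.1 h1).card_eq⟩
      have h1 := Finset.card_le_card this
      rw [Finset.card_powersetCard, Finset.card_compl, Nat.choose_one_right] at h1
      rw [Nat.choose_one_right, if_pos rfl]
      omega
    | i + 2 =>
      refine (Finset.card_filter_le _ _).trans ((card_cliques_le hG hirr i).trans ?_)
      rw [show k - 1 - 2 * a + 1 = k - 2 * a by omega]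
      simp
  have h1 := (card_cliques_le_sum (G := G) A r).trans
    (Finset.sum_le_sum fun p _ => Nat.mul_le_mul_left _ (hc p.2))
  simp_rw [mul_add] at h1
  rw [Finset.sum_add_distrib, ← Nat.add_choose_eq, Finset.sum_eq_single (r - 1, 1)] at h1
  · rw [if_pos rfl, show A.card + (k - 2 * a) = k - a by omega] at h1
    have h2 : (x : ℤ) = Fintype.card V - k + a := by omega
    rw [hr, ← h2, mul_comm]
    exact_mod_cast h1
  · rintro ⟨i, j⟩ hp hne
    rw [Finset.HasAntidiagonal.mem_antidiagonal] at hp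
    simp only at hp
    rw [if_neg, mul_zero]
    rintro rfl
    exact hne (by rw [← hp]; rfl)
  · intro h
    exact absurd (Finset.HasAntidiagonal.mem_antidiagonal.2 (show r - 1 + 1 = r by omega)) h

lemma exists_isolated {A : Finset V} (hG : LinearForestBound (isolate G A) t)
    (hirr : Irreducible (isolate G A) t) (hcard : A.card + 2 * t < Fintype.card V) :
    ∃ w, degN G w ≤ A.card := by
  have h1 := card_support_le hG hirr
  set S := Finset.univ.filter fun v => ∃ u, (isolate G A).Adj v u with hS
  obtain ⟨w, -, hw⟩ : ∃ w ∈ Finset.univ, w ∉ A ∪ S := by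
    refine Finset.exists_mem_notMem_of_card_lt_card ?_
    have := Finset.card_union_le A S
    rw [Finset.card_univ]
    omega
  rw [Finset.mem_union, not_or] at hw
  refine ⟨w, ?_⟩
  rw [degN, ← Set.ncard_coe_finset]
  refine Set.ncard_le_ncard (fun u hu => ?_) (Set.toFinite _)
  by_contra huA
  exact hw.2 (Finset.mem_filter.2 ⟨Finset.mem_univ _, u, hu, hw.1, huA⟩)

end Counting

section Classification

variable {V : Type*} {F : SimpleGraph V}

lemma LinearForestBound.not_path_five (hF : LinearForestBound F 3) {a b c d e : V}
    (hab : F.Adj a b) (hbc : F.Adj b c) (hcd : F.Adj c d) (hde : F.Adj d e) :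
    ¬ [a, b, c, d, e].Nodup := by
  intro h
  have := hF _ h
  simp only [adjCount_cons_cons, adjInd_of_adj hab, adjInd_of_adj hbc, adjInd_of_adj hcd,
    adjInd_of_adj hde] at this
  omega

lemma LinearForestBound.not_path_four_add_edge (hF : LinearForestBound F 3) {a b c d e f : V}
    (hab : F.Adj a b) (hbc : F.Adj b c) (hcd : F.Adj c d) (hef : F.Adj e f) :
    ¬ [a, b, c, d, e, f].Nodup := by
  intro h
  have := hF _ h
  simp only [adjCount_cons_cons, adjInd_of_adj hab, adjInd_of_adj hbc, adjInd_of_adj hcd,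
    adjInd_of_adj hef] at this
  omega

lemma LinearForestBound.not_two_path_three (hF : LinearForestBound F 3) {a b c d e f : V}
    (hab : F.Adj a b) (hbc : F.Adj b c) (hde : F.Adj d e) (hef : F.Adj e f) :
    ¬ [a, b, c, d, e, f].Nodup := by
  intro h
  have := hF _ h
  simp only [adjCount_cons_cons, adjInd_of_adj hab, adjInd_of_adj hbc, adjInd_of_adj hde,
    adjInd_of_adj hef] at this
  omega

lemma LinearForestBound.not_path_three_add_two_edges (hF : LinearForestBound F 3)
    {a b c d e f g : V} (hab : F.Adj a b) (hbc : F.Adj b c) (hde : F.Adj d e) (hfg : F.Adj f g) :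
    ¬ [a, b, c, d, e, f, g].Nodup := by
  intro h
  have := hF _ h
  simp only [adjCount_cons_cons, adjInd_of_adj hab, adjInd_of_adj hbc, adjInd_of_adj hde,
    adjInd_of_adj hfg] at this
  omega

lemma LinearForestBound.not_four_edges (hF : LinearForestBound F 3) {a b c d e f g h : V}
    (hab : F.Adj a b) (hcd : F.Adj c d) (hef : F.Adj e f) (hgh : F.Adj g h) :
    ¬ [a, b, c, d, e, f, g, h].Nodup := by
  intro hn
  have := hF _ hn
  simp only [adjCount_cons_cons, adjInd_of_adj hab, adjInd_of_adj hcd, adjInd_of_adj hef,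
    adjInd_of_adj hgh] at this
  omega

/-- All edges avoiding one non-isolated vertex lie inside a set of two vertices. -/
def IsStarLike (F : SimpleGraph V) : Prop :=
  ∃ q, (∃ u, F.Adj q u) ∧ ∃ B : Finset V, B.card ≤ 2 ∧
    ∀ u v, F.Adj u v → u ≠ q → v ≠ q → u ∈ B

/-- All edges lie inside a set of four vertices. -/
def IsSmall (F : SimpleGraph V) : Prop :=
  ∃ B : Finset V, B.card ≤ 4 ∧ ∀ u v, F.Adj u v → u ∈ B

/-- All edges lie inside the disjoint union of a triangle and an edge, whose vertices are all
non-isolated. -/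
def IsTriangleAddEdge (F : SimpleGraph V) : Prop :=
  ∃ x y z p q, [x, y, z, p, q].Nodup ∧ (∀ w ∈ [x, y, z, p, q], ∃ u, F.Adj w u) ∧
    ∀ u v, F.Adj u v →
    (u ∈ [x, y, z] ∧ v ∈ [x, y, z]) ∨ (u = p ∧ v = q) ∨ (u = q ∧ v = p)

/-- All edges lie inside a matching of size three, whose vertices are all non-isolated. -/
def IsThreeEdges (F : SimpleGraph V) : Prop :=
  ∃ x y p q r s, [x, y, p, q, r, s].Nodup ∧ (∀ w ∈ [x, y, p, q, r, s], ∃ u, F.Adj w u) ∧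
    ∀ u v, F.Adj u v →
    (u = x ∧ v = y) ∨ (u = y ∧ v = x) ∨ (u = p ∧ v = q) ∨ (u = q ∧ v = p) ∨
      (u = r ∧ v = s) ∨ (u = s ∧ v = r)

lemma LinearForestBound.eq_of_three_edges (hF : LinearForestBound F 3) {x y p q r s : V}
    (hn : [x, y, p, q, r, s].Nodup) (hxy : F.Adj x y) (hpq : F.Adj p q) (hrs : F.Adj r s)
    {v : V} (hv : F.Adj x v) : v = y := by
  by_contra hvy
  have hvx := hv.ne
  have h1 := hF.not_path_four_add_edge hxy.symm hv (d := q) (e := r) (f := s)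
  have h2 := hF.not_path_four_add_edge hxy.symm hv (d := p) (e := r) (f := s)
  have h3 := hF.not_path_four_add_edge hxy.symm hv (d := s) (e := p) (f := q)
  have h4 := hF.not_path_four_add_edge hxy.symm hv (d := r) (e := p) (f := q)
  have h5 := hF.not_path_three_add_two_edges hv.symm hxy hpq hrs
  have hqp := hpq.symm
  have hsr := hrs.symm
  simp only [List.nodup_cons, List.mem_cons, List.not_mem_nil, List.nodup_nil] at *
  grind

lemma LinearForestBound.isThreeEdges (hF : LinearForestBound F 3) {x y p q r s : V}
    (hn : [x, y, p, q, r, s].Nodup) (hxy : F.Adj x y) (hpq : F.Adj p q) (hrs : F.Adj r s) :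
    IsThreeEdges F := by
  refine ⟨x, y, p, q, r, s, hn, by
    simp only [List.forall_mem_cons, List.not_mem_nil, false_imp_iff, implies_true, and_true]
    exact ⟨⟨y, hxy⟩, ⟨x, hxy.symm⟩, ⟨q, hpq⟩, ⟨p, hpq.symm⟩, ⟨s, hrs⟩, ⟨r, hrs.symm⟩⟩,
    fun u v huv => ?_⟩
  have h1 : ∀ v, F.Adj x v → v = y := fun v => hF.eq_of_three_edges hn hxy hpq hrs
  have h2 : ∀ v, F.Adj y v → v = x := fun v =>
    hF.eq_of_three_edges (by
        simp only [List.nodup_cons, List.mem_cons, List.not_mem_nil, List.nodup_nil] at *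
        grind) hxy.symm hpq hrs
  have h3 : ∀ v, F.Adj p v → v = q := fun v =>
    hF.eq_of_three_edges (by
        simp only [List.nodup_cons, List.mem_cons, List.not_mem_nil, List.nodup_nil] at *
        grind) hpq hxy hrs
  have h4 : ∀ v, F.Adj q v → v = p := fun v =>
    hF.eq_of_three_edges (by
        simp only [List.nodup_cons, List.mem_cons, List.not_mem_nil, List.nodup_nil] at *
        grind) hpq.symm hxy hrs
  have h5 : ∀ v, F.Adj r v → v = s := fun v =>
    hF.eq_of_three_edges (by
        simp only [List.nodup_cons, List.mem_cons, List.not_mem_nil, List.nodup_nil] at *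
        grind) hrs hxy hpq
  have h6 : ∀ v, F.Adj s v → v = r := fun v =>
    hF.eq_of_three_edges (by
        simp only [List.nodup_cons, List.mem_cons, List.not_mem_nil, List.nodup_nil] at *
        grind) hrs.symm hxy hpq
  have h7 := hF.not_four_edges huv hxy hpq hrs
  have h8 := huv.symm
  have h9 := huv.ne
  simp only [List.nodup_cons, List.mem_cons, List.not_mem_nil, List.nodup_nil] at *
  grind (splits := 30)

lemma LinearForestBound.isStarLike_of_path_four (hF : LinearForestBound F 3) {p q r s x : V}
    (hn : [p, q, r, s].Nodup) (hpq : F.Adj p q) (hqr : F.Adj q r) (hrs : F.Adj r s)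
    (hqx : F.Adj q x) (hx : x ∉ [p, q, r, s]) : IsStarLike F := by
  refine ⟨q, ⟨x, hqx⟩, {r, s}, Finset.card_le_two, ?_⟩
  have hpr : ¬ F.Adj p r := fun h => hF.not_path_five hqx.symm hpq.symm h hrs (by
      simp only [List.nodup_cons, List.mem_cons, List.not_mem_nil, List.nodup_nil] at *
      grind)
  have hps : ¬ F.Adj p s := fun h => hF.not_path_five hqx.symm hpq.symm h hrs.symm (by
      simp only [List.nodup_cons, List.mem_cons, List.not_mem_nil, List.nodup_nil] at *
      grind)
  have hrx : ¬ F.Adj x r := fun h => hF.not_path_five hpq hqx h hrs (by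
      simp only [List.nodup_cons, List.mem_cons, List.not_mem_nil, List.nodup_nil] at *
      grind)
  have hp : ∀ v, v ∉ [p, q, r, s] → ¬ F.Adj v p := fun v hv h =>
    hF.not_path_five h hpq hqr hrs (by
        simp only [List.nodup_cons, List.mem_cons, List.not_mem_nil, List.nodup_nil] at *
        grind)
  have hs : ∀ v, v ∉ [p, q, r, s] → ¬ F.Adj v s := fun v hv h =>
    hF.not_path_five h hrs.symm hqr.symm hpq.symm (by
        simp only [List.nodup_cons, List.mem_cons, List.not_mem_nil, List.nodup_nil] at *
        grind)
  have hr : ∀ v, v ∉ [p, q, r, s] → v ≠ x → ¬ F.Adj v r := fun v hv hvx h =>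
    hF.not_two_path_three hpq hqx h hrs (by
        simp only [List.nodup_cons, List.mem_cons, List.not_mem_nil, List.nodup_nil] at *
        grind)
  intro u v huv huq hvq
  have h1 := hF.not_path_four_add_edge hpq hqr hrs huv
  have h2 := huv.symm
  have h3 := huv.ne
  simp only [List.nodup_cons, List.mem_cons, List.not_mem_nil, List.nodup_nil, Finset.mem_insert,
    Finset.mem_singleton] at *
  grind +splitImp (splits := 20)

lemma LinearForestBound.isStarLike_or_isSmall_of_path_four (hF : LinearForestBound F 3)
    {p q r s : V} (hn : [p, q, r, s].Nodup) (hpq : F.Adj p q) (hqr : F.Adj q r)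
    (hrs : F.Adj r s) : IsStarLike F ∨ IsSmall F := by
  by_cases hq : ∃ x, F.Adj q x ∧ x ∉ [p, q, r, s]
  · obtain ⟨x, hx, hx'⟩ := hq
    exact Or.inl (hF.isStarLike_of_path_four hn hpq hqr hrs hx hx')
  by_cases hr : ∃ x, F.Adj r x ∧ x ∉ [p, q, r, s]
  · obtain ⟨x, hx, hx'⟩ := hr
    exact Or.inl (hF.isStarLike_of_path_four (by
        simp only [List.nodup_cons, List.mem_cons, List.not_mem_nil, List.nodup_nil] at *
        grind) hrs.symm hqr.symm hpq.symm hx (by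
        simp only [List.nodup_cons, List.mem_cons, List.not_mem_nil, List.nodup_nil] at *
        grind))
  push Not at hq hr
  refine Or.inr ⟨{p, q, r, s}, Finset.card_le_four, ?_⟩
  have hp : ∀ v, v ∉ [p, q, r, s] → ¬ F.Adj v p := fun v hv h =>
    hF.not_path_five h hpq hqr hrs (by
        simp only [List.nodup_cons, List.mem_cons, List.not_mem_nil, List.nodup_nil] at *
        grind)
  have hs : ∀ v, v ∉ [p, q, r, s] → ¬ F.Adj v s := fun v hv h =>
    hF.not_path_five h hrs.symm hqr.symm hpq.symm (by
        simp only [List.nodup_cons, List.mem_cons, List.not_mem_nil, List.nodup_nil] at *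
        grind)
  intro u v huv
  have h1 := hF.not_path_four_add_edge hpq hqr hrs huv
  have h2 := huv.symm
  have h3 := huv.ne
  simp only [List.nodup_cons, List.mem_cons, List.not_mem_nil, List.nodup_nil, Finset.mem_insert,
    Finset.mem_singleton] at *
  grind

lemma LinearForestBound.of_path_three_add_edge (hF : LinearForestBound F 3)
    (h4 : ∀ a b c d, F.Adj a b → F.Adj b c → F.Adj c d → ¬ [a, b, c, d].Nodup) {q p x r s : V}
    (hn : [q, p, x, r, s].Nodup) (hqp : F.Adj q p) (hpx : F.Adj p x) (hrs : F.Adj r s) :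
    IsStarLike F ∨ IsTriangleAddEdge F := by
  have hq : ∀ v, v ∉ [q, p, x] → ¬ F.Adj v q := fun v hv h => h4 _ _ _ _ h hqp hpx (by
      simp only [List.nodup_cons, List.mem_cons, List.not_mem_nil, List.nodup_nil] at *
      grind)
  have hx : ∀ v, v ∉ [q, p, x] → ¬ F.Adj v x := fun v hv h =>
    h4 _ _ _ _ h hpx.symm hqp.symm (by
        simp only [List.nodup_cons, List.mem_cons, List.not_mem_nil, List.nodup_nil] at *
        grind)
  have hr : ∀ v, v ∉ [q, p, x, r, s] → ¬ F.Adj v r := fun v hv h =>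
    hF.not_two_path_three hqp hpx h hrs (by
        simp only [List.nodup_cons, List.mem_cons, List.not_mem_nil, List.nodup_nil] at *
        grind)
  have hs : ∀ v, v ∉ [q, p, x, r, s] → ¬ F.Adj v s := fun v hv h =>
    hF.not_two_path_three hqp hpx h hrs.symm (by
        simp only [List.nodup_cons, List.mem_cons, List.not_mem_nil, List.nodup_nil] at *
        grind)
  have hout : ∀ u v, F.Adj u v → u ∈ [q, p, x, r, s] ∨ v ∈ [q, p, x, r, s] := fun u v huv => by
    have h1 := hF.not_path_three_add_two_edges hqp hpx hrs huv
    have h3 := huv.ne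
    simp only [List.nodup_cons, List.mem_cons, List.not_mem_nil, List.nodup_nil] at *
    grind
  by_cases hqx : F.Adj q x
  · refine Or.inr ⟨q, p, x, r, s, hn, by
      simp only [List.forall_mem_cons, List.not_mem_nil, false_imp_iff, implies_true, and_true]
      exact ⟨⟨p, hqp⟩, ⟨q, hqp.symm⟩, ⟨p, hpx.symm⟩, ⟨s, hrs⟩, ⟨r, hrs.symm⟩⟩, ?_⟩
    have hp : ∀ v, v ∉ [q, p, x] → ¬ F.Adj v p := fun v hv h =>
      h4 _ _ _ _ h hqp.symm hqx (by
          simp only [List.nodup_cons, List.mem_cons, List.not_mem_nil, List.nodup_nil] at *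
          grind)
    intro u v huv
    have h1 := hout u v huv
    have h2 := huv.symm
    have h3 := huv.ne
    simp only [List.nodup_cons, List.mem_cons, List.not_mem_nil, List.nodup_nil] at *
    grind
  · refine Or.inl ⟨p, ⟨x, hpx⟩, {r, s}, Finset.card_le_two, ?_⟩
    intro u v huv hup hvp
    have h1 := hout u v huv
    have h2 := huv.symm
    have h3 := huv.ne
    simp only [List.nodup_cons, List.mem_cons, List.not_mem_nil, List.nodup_nil, Finset.mem_insert,
      Finset.mem_singleton] at *
    grind

lemma LinearForestBound.classification (hF : LinearForestBound F 3) :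
    IsStarLike F ∨ IsSmall F ∨ IsTriangleAddEdge F ∨ IsThreeEdges F := by
  by_cases hm3 : ∃ x y p q r s, [x, y, p, q, r, s].Nodup ∧ F.Adj x y ∧ F.Adj p q ∧ F.Adj r s
  · obtain ⟨x, y, p, q, r, s, hn, hxy, hpq, hrs⟩ := hm3
    exact Or.inr (Or.inr (Or.inr (hF.isThreeEdges hn hxy hpq hrs)))
  by_cases h4 : ∃ a b c d, F.Adj a b ∧ F.Adj b c ∧ F.Adj c d ∧ [a, b, c, d].Nodup
  · obtain ⟨a, b, c, d, hab, hbc, hcd, hn⟩ := h4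
    rcases hF.isStarLike_or_isSmall_of_path_four hn hab hbc hcd with h | h <;> simp [h]
  by_cases h32 : ∃ q p x r s, [q, p, x, r, s].Nodup ∧ F.Adj q p ∧ F.Adj p x ∧ F.Adj r s
  · obtain ⟨q, p, x, r, s, hn, hqp, hpx, hrs⟩ := h32
    push Not at h4
    rcases hF.of_path_three_add_edge h4 hn hqp hpx hrs with h | h <;> simp [h]
  by_cases h0 : ∃ p q, F.Adj p q
  swap
  · push Not at h0
    exact Or.inr (Or.inl ⟨∅, by simp, fun u v h => (h0 u v h).elim⟩)
  obtain ⟨p, q, hpq⟩ := h0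
  by_cases h2 : ∃ r s, F.Adj r s ∧ [p, q, r, s].Nodup
  · obtain ⟨r, s, hrs, hn⟩ := h2
    refine Or.inr (Or.inl ⟨{p, q, r, s}, Finset.card_le_four, fun u v huv => ?_⟩)
    by_contra hu
    have h1 : ¬ [p, q, r, s, u, v].Nodup := fun h => hm3 ⟨_, _, _, _, _, _, h, hpq, hrs, huv⟩
    have h5 : v = p → False := fun h => h32 ⟨u, p, q, r, s, by
        clear hm3 h4 h32
        simp only [List.nodup_cons, List.mem_cons, List.not_mem_nil, List.nodup_nil] at *
        grind, h ▸ huv, hpq, hrs⟩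
    have h6 : v = q → False := fun h => h32 ⟨u, q, p, r, s, by
        clear hm3 h4 h32
        simp only [List.nodup_cons, List.mem_cons, List.not_mem_nil, List.nodup_nil] at *
        grind, h ▸ huv, hpq.symm, hrs⟩
    have h7 : v = r → False := fun h => h32 ⟨u, r, s, p, q, by
        clear hm3 h4 h32
        simp only [List.nodup_cons, List.mem_cons, List.not_mem_nil, List.nodup_nil] at *
        grind, h ▸ huv, hrs, hpq⟩
    have h8 : v = s → False := fun h => h32 ⟨u, s, r, p, q, by
        clear hm3 h4 h32
        simp only [List.nodup_cons, List.mem_cons, List.not_mem_nil, List.nodup_nil] at *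
        grind, h ▸ huv, hrs.symm, hpq⟩
    have h9 := huv.ne
    simp only [List.nodup_cons, List.mem_cons, List.not_mem_nil, List.nodup_nil, Finset.mem_insert,
      Finset.mem_singleton] at *
    grind
  have key : ∀ p q x, F.Adj p q → (∀ r s, F.Adj r s → ¬ [p, q, r, s].Nodup) → F.Adj p x → x ≠ q →
      IsStarLike F := by
    intro p q x hpq h2 hpx hxq
    by_cases h3 : ∃ y, F.Adj q y ∧ y ≠ p ∧ y ≠ x
    · obtain ⟨y, hqy, hyp, hyx⟩ := h3
      exact (h4 ⟨x, p, q, y, hpx.symm, hpq, hqy, by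
        have := hpq.ne; have := hpx.ne; have := hqy.ne; clear hm3 h4 h32
        simp only [List.nodup_cons, List.mem_cons, List.not_mem_nil, List.nodup_nil] at *
        grind⟩).elim
    · push Not at h3
      refine ⟨p, ⟨q, hpq⟩, {q, x}, Finset.card_le_two, fun u v huv hu hv => ?_⟩
      have h5 := h2 u v huv
      have h6 := h3 v
      have h7 := h3 u
      have h8 := huv.symm
      have := hpq.ne
      have := huv.ne
      simp only [List.nodup_cons, List.mem_cons, List.not_mem_nil, List.nodup_nil,
        Finset.mem_insert, Finset.mem_singleton] at *
      grind
  push Not at h2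
  by_cases hp : ∃ x, F.Adj p x ∧ x ≠ q
  · obtain ⟨x, hpx, hxq⟩ := hp
    exact Or.inl (key p q x hpq h2 hpx hxq)
  by_cases hq : ∃ x, F.Adj q x ∧ x ≠ p
  · obtain ⟨x, hqx, hxp⟩ := hq
    refine Or.inl (key q p x hpq.symm (fun r s hrs => ?_) hqx hxp)
    have := h2 r s hrs
    simp only [List.nodup_cons, List.mem_cons, List.not_mem_nil, List.nodup_nil] at *
    grind
  · push Not at hp hq
    refine Or.inr (Or.inl ⟨{p, q}, Finset.card_le_two.trans (by norm_num), fun u v huv => ?_⟩)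
    have h5 := h2 u v huv
    have h6 := huv.symm
    have := hpq.ne
    have := huv.ne
    simp only [List.nodup_cons, List.mem_cons, List.not_mem_nil, List.nodup_nil, Finset.mem_insert,
      Finset.mem_singleton] at *
    grind

end Classification

section Embedding

variable {V : Type*} [Fintype V] {G : SimpleGraph V}

lemma exists_embedding {n : ℕ} (hcard : Fintype.card V = n) (A : Finset V) {M : List V}
    (hM : M.Nodup) (hAM : ∀ x ∈ M, x ∉ A) : ∃ f : V ↪ Fin n, (∀ v ∈ A, (f v : ℕ) < A.card) ∧
      ∀ i (h : i < M.length), (f M[i] : ℕ) = A.card + i := by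
  have hAM' : (A.toList ++ M).Nodup := List.nodup_append.2
    ⟨A.nodup_toList, hM, fun a ha b hb e => hAM b hb (e ▸ Finset.mem_toList.1 ha)⟩
  obtain ⟨R, hR, hall, -⟩ := exists_extension Finset.univ hAM'
  have hall : ∀ x, x ∈ A.toList ++ M ++ R := fun x => hall x (Finset.mem_univ x)
  have hlen : (A.toList ++ M ++ R).length = n := by
    rw [← hcard, ← List.toFinset_card_of_nodup hR, ← Finset.card_univ]
    congr 1
    exact Finset.eq_univ_of_forall fun x => List.mem_toFinset.2 (hall x)
  refine ⟨⟨fun v => ⟨(A.toList ++ M ++ R).idxOf v, hlen ▸ List.idxOf_lt_length_of_mem (hall v)⟩,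
    fun u v h => (List.idxOf_inj (hall u)).1 (Fin.mk.inj_iff.1 h)⟩, fun v hv => ?_, fun i h => ?_⟩
  · have hv' := Finset.mem_toList.2 hv
    change (A.toList ++ M ++ R).idxOf v < _
    rw [List.append_assoc, List.idxOf_append_of_mem hv', ← Finset.length_toList]
    exact List.idxOf_lt_length_of_mem hv'
  · change (A.toList ++ M ++ R).idxOf M[i] = _
    have h1 : (A.toList ++ M ++ R)[A.card + i]? = some M[i] := by
      rw [List.append_assoc, List.getElem?_append_right (by simp),
        List.getElem?_append_left (by simpa using h)]
      simp
    obtain ⟨h2, h3⟩ := List.getElem?_eq_some_iff.1 h1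
    rw [← h3, hR.idxOf_getElem]

omit [Fintype V] in
lemma mem_or_isolate_adj {A : Finset V} {u v : V} (h : G.Adj u v) :
    u ∈ A ∨ v ∈ A ∨ (isolate G A).Adj u v := by
  by_cases hu : u ∈ A
  · exact Or.inl hu
  by_cases hv : v ∈ A
  · exact Or.inr (Or.inl hv)
  · exact Or.inr (Or.inr ⟨h, hu, hv⟩)

lemma isoSubgraph_HGraph {n k : ℕ} (hcard : Fintype.card V = n) {A B : Finset V}
    (hB : B.card ≤ k - 2 * A.card)
    (h : ∀ u v, (isolate G A).Adj u v → u ∈ B) : IsoSubgraph G (HGraph n k A.card) := by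
  obtain ⟨f, hfA, hfB⟩ := exists_embedding hcard A (M := (B \ A).toList) (Finset.nodup_toList _)
    (fun x hx => (Finset.mem_sdiff.1 (Finset.mem_toList.1 hx)).2)
  have hfB' : ∀ v ∈ B, v ∉ A → (f v : ℕ) < k - A.card := by
    intro v hv hvA
    obtain ⟨i, hi, rfl⟩ := List.getElem_of_mem
      (Finset.mem_toList.2 (Finset.mem_sdiff.2 ⟨hv, hvA⟩))
    rw [hfB i hi]
    rw [Finset.length_toList] at hi
    have := Finset.card_le_card (Finset.sdiff_subset (s := B) (t := A))
    omega
  refine ⟨f, fun u v huv => ?_⟩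
  rw [HGraph, SimpleGraph.fromRel_adj]
  refine ⟨fun e => huv.ne (f.injective e), ?_⟩
  rcases mem_or_isolate_adj (A := A) huv with hu | hv | huv'
  · exact Or.inl (Or.inl (hfA u hu))
  · exact Or.inr (Or.inl (hfA v hv))
  · exact Or.inl (Or.inr ⟨hfB' u (h u v huv') huv'.2.1, hfB' v (h v u huv'.symm) huv'.2.2⟩)

lemma isoSubgraph_HplusGraph {n : ℕ} (hcard : Fintype.card V = n) {A : Finset V}
    (hF : IsTriangleAddEdge (isolate G A)) :
    IsoSubgraph G (HplusGraph n (2 * A.card + 3) A.card) := by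
  obtain ⟨x, y, z, p, q, hn, hne, h⟩ := hF
  obtain ⟨f, hfA, hf⟩ := exists_embedding hcard A hn fun w hw => (hne w hw).choose_spec.2.1
  have hx : (f x : ℕ) = A.card + 0 := hf 0 (by simp)
  have hy : (f y : ℕ) = A.card + 1 := hf 1 (by simp)
  have hz : (f z : ℕ) = A.card + 2 := hf 2 (by simp)
  have hp : (f p : ℕ) = A.card + 3 := hf 3 (by simp)
  have hq : (f q : ℕ) = A.card + 4 := hf 4 (by simp)
  have hlt : ∀ w ∈ [x, y, z], (f w : ℕ) < 2 * A.card + 3 - A.card := by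
    simp only [List.forall_mem_cons, List.not_mem_nil, false_imp_iff, implies_true, and_true]
    omega
  refine ⟨f, fun u v huv => ?_⟩
  rw [HplusGraph, SimpleGraph.fromRel_adj]
  refine ⟨fun e => huv.ne (f.injective e), ?_⟩
  rcases mem_or_isolate_adj (A := A) huv with hu | hv | huv'
  · exact Or.inl (Or.inl (hfA u hu))
  · exact Or.inr (Or.inl (hfA v hv))
  · rcases h u v huv' with ⟨hu, hv⟩ | ⟨rfl, rfl⟩ | ⟨rfl, rfl⟩
    · exact Or.inl (Or.inr (Or.inl ⟨hlt u hu, hlt v hv⟩))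
    all_goals omega

lemma isoSubgraph_HplusplusGraph {n : ℕ} (hcard : Fintype.card V = n) {A : Finset V}
    (hF : IsThreeEdges (isolate G A)) :
    IsoSubgraph G (HplusplusGraph n (2 * A.card + 2) A.card) := by
  obtain ⟨x, y, p, q, r, s, hn, hne, h⟩ := hF
  obtain ⟨f, hfA, hf⟩ := exists_embedding hcard A hn fun w hw => (hne w hw).choose_spec.2.1
  have hx : (f x : ℕ) = A.card + 0 := hf 0 (by simp)
  have hy : (f y : ℕ) = A.card + 1 := hf 1 (by simp)
  have hp : (f p : ℕ) = A.card + 2 := hf 2 (by simp)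
  have hq : (f q : ℕ) = A.card + 3 := hf 3 (by simp)
  have hr : (f r : ℕ) = A.card + 4 := hf 4 (by simp)
  have hs : (f s : ℕ) = A.card + 5 := hf 5 (by simp)
  refine ⟨f, fun u v huv => ?_⟩
  rw [HplusplusGraph, SimpleGraph.fromRel_adj]
  refine ⟨fun e => huv.ne (f.injective e), ?_⟩
  rcases mem_or_isolate_adj (A := A) huv with hu | hv | huv'
  · exact Or.inl (Or.inl (hfA u hu))
  · exact Or.inr (Or.inl (hfA v hv))
  · rcases h u v huv' with ⟨rfl, rfl⟩ | ⟨rfl, rfl⟩ | ⟨rfl, rfl⟩ | ⟨rfl, rfl⟩ | ⟨rfl, rfl⟩ |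
      ⟨rfl, rfl⟩
    all_goals omega

lemma LinearForestBound.isoSubgraph_of_one {n k : ℕ} (hcard : Fintype.card V = n) {A : Finset V}
    (hk : k = 2 * A.card + 2) (hF : LinearForestBound (isolate G A) 1) :
    IsoSubgraph G (HGraph n k A.card) := by
  by_cases h : ∃ p q, (isolate G A).Adj p q
  swap
  · push Not at h
    exact isoSubgraph_HGraph hcard (B := ∅) (by simp) fun u v huv => (h u v huv).elim
  obtain ⟨p, q, hpq⟩ := h
  refine isoSubgraph_HGraph hcard (B := {p, q}) (Finset.card_le_two.trans (by omega))
    fun u v huv => ?_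
  by_contra hu
  rw [Finset.mem_insert, Finset.mem_singleton, not_or] at hu
  have hne := huv.ne
  have hpq' := hpq.ne
  by_cases hvp : v = p
  · subst hvp
    have := hF [u, v, q] (by simp [hne, hu.2, hpq'])
    simp only [adjCount_cons_cons, adjInd_of_adj huv, adjInd_of_adj hpq] at this
    omega
  by_cases hvq : v = q
  · subst hvq
    have := hF [u, v, p] (by simp [hne, hu.1, hpq'.symm])
    simp only [adjCount_cons_cons, adjInd_of_adj huv, adjInd_of_adj hpq.symm] at this
    omega
  · have := hF [u, v, p, q] (by simp [hne, hu.1, hu.2, hvp, hvq, hpq'])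
    simp only [adjCount_cons_cons, adjInd_of_adj huv, adjInd_of_adj hpq] at this
    omega

lemma LinearForestBound.isoSubgraph_of_three {n : ℕ} (hcard : Fintype.card V = n) {A : Finset V}
    (hF : LinearForestBound (isolate G A) 3) :
    IsoSubgraph G (HGraph n (2 * A.card + 4) (A.card + 1)) ∨
      IsoSubgraph G (HGraph n (2 * A.card + 4) A.card) ∨
      IsoSubgraph G (HplusGraph n (2 * A.card + 3) A.card) ∨
      IsoSubgraph G (HplusplusGraph n (2 * A.card + 2) A.card) := by
  rcases hF.classification with h | ⟨B, hB, h⟩ | h | h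
  · left
    obtain ⟨q, ⟨w, hqw⟩, B, hB, h⟩ := h
    rw [← Finset.card_insert_of_notMem hqw.2.1]
    refine isoSubgraph_HGraph hcard (B := B) ?_ fun u v huv => ?_
    · rw [Finset.card_insert_of_notMem hqw.2.1]
      omega
    · obtain ⟨huv, hu, hv⟩ := huv
      rw [Finset.mem_insert, not_or] at hu hv
      exact h u v ⟨huv, hu.2, hv.2⟩ hu.1 hv.1
  · exact Or.inr (Or.inl (isoSubgraph_HGraph hcard (hB.trans (by omega)) h))
  · exact Or.inr (Or.inr (Or.inl (isoSubgraph_HplusGraph hcard h)))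
  · exact Or.inr (Or.inr (Or.inr (isoSubgraph_HplusplusGraph hcard h)))

end Embedding

end LinearForestStability

open LinearForestStability

/-- stability, even case. Let `k` be even and positive, and let `G` be an
`𝓛ₖ`-free graph on `n > k^5` vertices with minimum degree at least `d`. If
`2 ≤ r ≤ ⌊(k-3)/2⌋` and `Nᵣ(G) > max { hᵣ(n,k,d), hᵣ(n,k,⌊(k-5)/2⌋) }`, then `G` is
isomorphic to a subgraph of `H(n,k,⌊(k-1)/2⌋)`, of `H(n,k,⌊(k-3)/2⌋)`, of
`H⁺(n,k-1,⌊(k-3)/2⌋)`, or of `H⁺⁺(n,k-2,⌊(k-3)/2⌋)`. -/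
theorem statement5 {V : Type*} [Fintype V] (G : SimpleGraph V) (n k d r : ℕ)
    (hcard : Fintype.card V = n) (hk : 0 < k) (heven : Even k)
    (hfree : LinearForestFree k G) (hmindeg : ∀ v, d ≤ degN G v)
    (hn : k ^ 5 < n) (hr2 : 2 ≤ r) (hrk : r ≤ (k - 3) / 2)
    (hNr : max (hr r n k d) (hr r n k ((k - 5) / 2)) < (Nr r G : ℤ)) :
    IsoSubgraph G (HGraph n k ((k - 1) / 2)) ∨
      IsoSubgraph G (HGraph n k ((k - 3) / 2)) ∨
      IsoSubgraph G (HplusGraph n (k - 1) ((k - 3) / 2)) ∨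
      IsoSubgraph G (HplusplusGraph n (k - 2) ((k - 3) / 2)) := by
  obtain ⟨m, rfl⟩ := heven
  have hm : 4 ≤ m := by omega
  have hkn : 16 * (m + m) < n := by
    refine lt_of_le_of_lt ?_ hn
    calc 16 * (m + m) ≤ (m + m) ^ 4 * (m + m) :=
          Nat.mul_le_mul_right _
            (le_trans (by norm_num) (Nat.pow_le_pow_left (by omega : 2 ≤ m + m) 4))
      _ = (m + m) ^ 5 := by ring
  obtain ⟨A, hA, hF, hirr⟩ := exists_irreducible_isolate
    fun L hL => lt_of_le_of_lt (linearForestBound_of_free hk hfree L hL) (Nat.sub_lt hk one_pos)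
  replace hirr := hirr (by omega)
  obtain ⟨w, hw⟩ := exists_isolated hF hirr (by omega)
  have hcl := card_cliques_le_hr hr2 hA (by omega) hF hirr
  rw [← Nr_eq_card_cliques, hcard] at hcl
  rcases le_or_gt A.card (m - 3) with ha | ha
  · have := hr_le_max (e := (m + m - 5) / 2) hr2 (by omega) ((hmindeg w).trans hw) (by omega)
      (by omega) (n := n) (k := m + m) (r := r)
    exact absurd (hcl.trans this) (not_le.2 hNr)
  obtain ha | ha : A.card = m - 1 ∨ A.card = m - 2 := by omega
  · left
    rw [show m + m - 1 - 2 * A.card = 1 by omega] at hF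
    rw [show (m + m - 1) / 2 = A.card by omega]
    exact hF.isoSubgraph_of_one hcard (by omega)
  · rw [show m + m - 1 - 2 * A.card = 3 by omega] at hF
    have := hF.isoSubgraph_of_three hcard
    rwa [show (m + m - 1) / 2 = A.card + 1 by omega, show (m + m - 3) / 2 = A.card by omega,
      show m + m - 1 = 2 * A.card + 3 by omega, show m + m - 2 = 2 * A.card + 2 by omega,
      show m + m = 2 * A.card + 4 by omega]
end

section
/- Let G be a graph on n vertices with matching number ν(G) ≤ k. Then the number of edges of G satisfies e(G) ≤ max{ h_2(n, 2k+1, 0), h_2(n, 2k+1, k) }. -/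
open SimpleGraph

open scoped FinsetFamily

/-- Compressing a family of finsets by moving `j` to `i` does not create larger matchings. -/
theorem exists_pairwiseDisjoint_of_subset_compression {α : Type*} [DecidableEq α] {i j : α}
    (hij : i ≠ j) {𝒜 M : Finset (Finset α)} (hM : M ⊆ 𝓒 {i} {j} 𝒜)
    (hd : (M : Set (Finset α)).PairwiseDisjoint id) :
    ∃ M' ⊆ 𝒜, M'.card = M.card ∧ (M' : Set (Finset α)).PairwiseDisjoint id := by
  by_cases hsub : M ⊆ 𝒜
  · exact ⟨M, hsub, rfl, hd⟩
  obtain ⟨e, heM, he⟩ := Finset.not_subset.1 hsub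
  have hie : i ∈ e := by
    simpa using UV.le_of_mem_compression_of_notMem (hM heM) he
  have hje : j ∉ e := by
    simpa using UV.disjoint_of_mem_compression_of_notMem (hM heM) he
  have heA := UV.sup_sdiff_mem_of_mem_compression_of_notMem (hM heM) he
  let σ := (Equiv.swap i j).toEmbedding
  have hσ : ∀ g : Finset α, ∀ x, x ∈ g.map σ ↔ Equiv.swap i j x ∈ g := by
    intro g x
    simp [σ, Finset.mem_map_equiv]
  refine ⟨M.map (Finset.mapEmbedding σ).toEmbedding, ?_, Finset.card_map _, ?_⟩
  · intro g' hg'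
    obtain ⟨g, hg, rfl⟩ := Finset.mem_map.1 hg'
    change g.map σ ∈ 𝒜
    by_cases hge : g = e
    · subst hge
      convert heA using 1
      ext x
      rw [hσ]
      simp only [Finset.sup_eq_union, Finset.mem_sdiff, Finset.mem_union, Finset.mem_singleton,
        Equiv.swap_apply_def]
      grind
    have hig : i ∉ g := fun h ↦ Finset.disjoint_left.1 (hd hg heM hge) h hie
    have hgA : g ∈ 𝒜 := by
      by_contra h
      exact hig (by simpa using UV.le_of_mem_compression_of_notMem (hM hg) h)
    by_cases hjg : j ∈ g
    · have := UV.sup_sdiff_mem_of_mem_compression (hM hg) (by simpa using hjg) (by simpa using hig)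
      convert this using 1
      ext x
      rw [hσ]
      simp only [Finset.sup_eq_union, Finset.mem_sdiff, Finset.mem_union, Finset.mem_singleton,
        Equiv.swap_apply_def]
      grind
    · convert hgA using 1
      ext x
      rw [hσ, Equiv.swap_apply_def]
      grind
  · intro a ha b hb hab
    obtain ⟨a', ha', rfl⟩ := Finset.mem_map.1 ha
    obtain ⟨b', hb', rfl⟩ := Finset.mem_map.1 hb
    exact (Finset.disjoint_map σ).2 (hd ha' hb' (by rintro rfl; exact hab rfl))

/-- Compressing a family of finsets of naturals downwards decreases the sum of all elements. -/
theorem sum_sum_compression_lt {i j : ℕ} (hij : i < j) {𝒜 : Finset (Finset ℕ)} {a : Finset ℕ}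
    (ha : a ∈ 𝒜) (hca : UV.compress {i} {j} a ∉ 𝒜) :
    ∑ b ∈ 𝓒 {i} {j} 𝒜, ∑ x ∈ b, x < ∑ b ∈ 𝒜, ∑ x ∈ b, x := by
  rw [UV.compression, Finset.sum_union UV.compress_disjoint, Finset.filter_image,
    Finset.sum_image UV.compress_injOn,
    ← Finset.sum_filter_add_sum_filter_not 𝒜 (fun b ↦ UV.compress {i} {j} b ∈ 𝒜),
    add_lt_add_iff_left]
  refine Finset.sum_lt_sum_of_nonempty ⟨a, by simp [ha, hca]⟩ fun b hb ↦ ?_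
  rw [Finset.mem_filter] at hb
  have hb' : Disjoint {i} b ∧ {j} ≤ b := by
    by_contra h
    rw [UV.compress, if_neg h] at hb
    exact hb.2 hb.1
  rw [UV.compress_of_disjoint_of_le hb'.1 hb'.2]
  have hi : i ∉ b := by simpa using hb'.1
  have hj : j ∈ b := by simpa using hb'.2
  have : (b ⊔ {i}) \ {j} = insert i (b.erase j) := by
    ext x
    simp only [Finset.sup_eq_union, Finset.mem_sdiff, Finset.mem_union, Finset.mem_singleton]
    grind
  rw [this, Finset.sum_insert (by simp [hi]), ← Finset.add_sum_erase b _ hj]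
  exact Nat.add_lt_add_right hij _

/-- A family of pairs in `range n` which is closed under decreasing elements and has no matching of
size `k + 1` is small. -/
theorem exists_card_le_of_shifted {n k : ℕ} {𝒜 : Finset (Finset ℕ)}
    (h𝒜 : 𝒜 ⊆ (Finset.range n).powersetCard 2)
    (hshift : ∀ i j, i < j → ∀ a ∈ 𝒜, i ∉ a → j ∈ a → insert i (a.erase j) ∈ 𝒜)
    (hM : ∀ M ⊆ 𝒜, (M : Set (Finset ℕ)).PairwiseDisjoint id → M.card ≤ k) :
    ∃ t ≤ k, 𝒜.card ≤ (2 * k + 1 - t).choose 2 + (n - (2 * k + 1 - t)) * t := by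
  obtain ⟨t, htk, ht⟩ : ∃ t ≤ k, ({t, 2 * k + 1 - t} : Finset ℕ) ∉ 𝒜 := by
    by_contra! h
    let p : ℕ → Finset ℕ := fun t ↦ {t, 2 * k + 1 - t}
    have hdis : ∀ s ≤ k, ∀ t ≤ k, s ≠ t → Disjoint (p s) (p t) := by
      intro s hs t ht hst
      simp only [p, Finset.disjoint_left, Finset.mem_insert, Finset.mem_singleton]
      omega
    have hinj : Set.InjOn p (Finset.range (k + 1)) := by
      intro s hs t ht hst
      by_contra hne
      have := hdis s (by simpa [Nat.lt_succ_iff] using hs) t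
        (by simpa [Nat.lt_succ_iff] using ht) hne
      rw [hst, disjoint_self] at this
      exact Finset.insert_ne_empty _ _ this
    have := hM ((Finset.range (k + 1)).image p) ?_ ?_
    · rw [Finset.card_image_of_injOn hinj, Finset.card_range] at this
      omega
    · simp only [Finset.image_subset_iff, Finset.mem_range, Nat.lt_succ_iff]
      exact h
    · intro a ha b hb hab
      simp only [Finset.coe_image, Finset.coe_range, Set.mem_image, Set.mem_Iio,
        Nat.lt_succ_iff] at ha hb
      obtain ⟨s, hs, rfl⟩ := ha
      obtain ⟨t, ht, rfl⟩ := hb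
      exact hdis s hs t ht (by rintro rfl; exact hab rfl)
  refine ⟨t, htk, ?_⟩
  set s := 2 * k + 1 - t with hs
  have hsub : 𝒜 ⊆ (Finset.range s).powersetCard 2 ∪
      (Finset.Ico s n ×ˢ Finset.range t).image (fun q ↦ {q.2, q.1}) := by
    have key : ∀ a b, a < b → ({a, b} : Finset ℕ) ∈ 𝒜 → b < n → b < s ∨ a < t := by
      intro a b hab hmem _
      by_contra! hcon
      have h1 : ({t, b} : Finset ℕ) ∈ 𝒜 := by
        obtain rfl | hta := hcon.2.eq_or_lt
        · exact hmem
        · convert hshift t a hta _ hmem (by simp; omega) (by simp) using 1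
          ext x; simp; omega
      apply ht
      obtain rfl | hsb := hcon.1.eq_or_lt
      · exact h1
      · convert hshift s b hsb _ h1 (by simp; omega) (by simp) using 1
        ext x; simp; omega
    have main : ∀ a b, a < b → ({a, b} : Finset ℕ) ∈ 𝒜 → b < n →
        {a, b} ∈ (Finset.range s).powersetCard 2 ∪
          (Finset.Ico s n ×ˢ Finset.range t).image (fun q ↦ {q.2, q.1}) := by
      intro a b hab hmem hbn
      rw [Finset.mem_union, Finset.mem_powersetCard, Finset.mem_image]
      by_cases hbs : b < s
      · left
        refine ⟨?_, Finset.card_pair hab.ne⟩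
        intro x
        simp
        omega
      · right
        refine ⟨(b, a), ?_, rfl⟩
        have := key a b hab hmem hbn
        simp
        omega
    intro e he
    obtain ⟨hen, hec⟩ := Finset.mem_powersetCard.1 (h𝒜 he)
    obtain ⟨a, b, hab, rfl⟩ := Finset.card_eq_two.1 hec
    have ha : a < n := Finset.mem_range.1 (hen (by simp))
    have hb : b < n := Finset.mem_range.1 (hen (by simp))
    obtain h | h := hab.lt_or_gt
    · exact main a b h he hb
    · rw [Finset.pair_comm] at he ⊢
      exact main b a h he ha
  refine (Finset.card_le_card hsub).trans ((Finset.card_union_le _ _).trans ?_)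
  refine add_le_add (by simp) (Finset.card_image_le.trans (by simp))

/-- A family of pairs in `range n` with no matching of size `k + 1` is at most as large as one of
the standard examples with parameter `t ≤ k`. -/
theorem exists_card_le_of_matching_le {n k : ℕ} (𝒜 : Finset (Finset ℕ))
    (h𝒜 : 𝒜 ⊆ (Finset.range n).powersetCard 2)
    (hM : ∀ M ⊆ 𝒜, (M : Set (Finset ℕ)).PairwiseDisjoint id → M.card ≤ k) :
    ∃ t ≤ k, 𝒜.card ≤ (2 * k + 1 - t).choose 2 + (n - (2 * k + 1 - t)) * t := by
  by_cases hshift : ∀ i j, i < j → ∀ a ∈ 𝒜, i ∉ a → j ∈ a → insert i (a.erase j) ∈ 𝒜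
  · exact exists_card_le_of_shifted h𝒜 hshift hM
  push Not at hshift
  obtain ⟨i, j, hij, a, ha, hia, hja, hins⟩ := hshift
  have hcomp : ∀ b : Finset ℕ, i ∉ b → j ∈ b →
      UV.compress {i} {j} b = insert i (b.erase j) := by
    intro b hi hj
    rw [UV.compress_of_disjoint_of_le (by simpa using hi) (by simpa using hj)]
    ext x
    simp only [Finset.sup_eq_union, Finset.mem_sdiff, Finset.mem_union, Finset.mem_singleton]
    grind
  have hlt := sum_sum_compression_lt hij ha (by rwa [hcomp a hia hja])
  rw [← UV.card_compression {i} {j} 𝒜]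
  refine exists_card_le_of_matching_le (𝓒 {i} {j} 𝒜) ?_ ?_
  · intro b hb
    rw [UV.mem_compression] at hb
    obtain hb | ⟨-, c, hc, rfl⟩ := hb
    · exact h𝒜 hb.1
    obtain ⟨hcn, hcc⟩ := Finset.mem_powersetCard.1 (h𝒜 hc)
    refine Finset.mem_powersetCard.2 ⟨?_, by rw [UV.card_compress (by simp), hcc]⟩
    unfold UV.compress
    split_ifs with h
    · have hj : j < n := Finset.mem_range.1 (hcn (h.2 (by simp)))
      intro x hx
      have hx : x = i ∨ x ∈ c := by
        simpa using (Finset.mem_sdiff.1 hx).1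
      obtain rfl | hx := hx
      · exact Finset.mem_range.2 (hij.trans hj)
      · exact hcn hx
    · exact hcn
  · intro M hMs hd
    obtain ⟨M', hM', hcard, hd'⟩ := exists_pairwiseDisjoint_of_subset_compression hij.ne hMs hd
    exact hcard ▸ hM M' hM' hd'
termination_by ∑ b ∈ 𝒜, ∑ x ∈ b, x

/-- The numbers `h₂(n, 2k+1, t)` with `t ≤ k` are maximized at an end point. -/
theorem hr_two_le_max {n k t : ℕ} (htk : t ≤ k) :
    hr 2 n (2 * k + 1) t ≤ max (hr 2 n (2 * k + 1) 0) (hr 2 n (2 * k + 1) k) := by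
  obtain ⟨d, rfl⟩ := Nat.exists_eq_add_of_le htk
  have hc : ∀ m : ℕ, (2 : ℤ) * ((m + 1).choose 2 : ℕ) = (m + 1) * m := by
    intro m
    have h : 2 * (m + 1).choose 2 = (m + 1) * m := by
      rw [Nat.choose_two_right, Nat.add_sub_cancel]
      exact Nat.mul_div_cancel' (Nat.even_mul_pred_self (m + 1)).two_dvd
    exact_mod_cast h
  have h0 := hc (2 * (t + d))
  have h1 := hc (t + 2 * d)
  have h2 := hc (t + d)
  unfold hr
  rw [show 2 * (t + d) + 1 - t = t + 2 * d + 1 by omega,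
    show 2 * (t + d) + 1 - (t + d) = t + d + 1 by omega, Nat.sub_zero, le_max_iff]
  simp only [Nat.add_one_sub_one, Nat.choose_one_right]
  push_cast at *
  simp only [mul_zero, add_zero]
  by_contra! hcon
  obtain ⟨ha, hb⟩ := hcon
  have ht : (0 : ℤ) ≤ t := by positivity
  have hd : (0 : ℤ) ≤ d := by positivity
  have hA : 0 < (t : ℤ) * (3 * t + 2 * n - 8 * (t + d) - 3) := by linarith
  have hB : 0 < (d : ℤ) * (- (3 * (2 * t + d) + 2 * n - 8 * (t + d) - 3)) := by linarith
  have hA' := pos_of_mul_pos_right hA ht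
  have hB' := pos_of_mul_pos_right hB hd
  linarith

/-- A family of pairwise disjoint edges gives a matching subgraph. -/
theorem card_le_of_pairwiseDisjoint {V : Type*} [Fintype V] {G : SimpleGraph V} {k : ℕ}
    (hnu : ∀ M : G.Subgraph, M.IsMatching → M.edgeSet.ncard ≤ k) (f : V ↪ ℕ)
    {M : Finset (Finset ℕ)} (hM : ∀ a ∈ M, ∃ u v, G.Adj u v ∧ {f u, f v} = a)
    (hd : (M : Set (Finset ℕ)).PairwiseDisjoint id) : M.card ≤ k := by
  let H : G.Subgraph :=
    { verts := {v | ∃ a ∈ M, f v ∈ a}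
      Adj := fun u v ↦ G.Adj u v ∧ {f u, f v} ∈ M
      adj_sub := fun h ↦ h.1
      edge_vert := fun h ↦ ⟨_, h.2, by simp⟩
      symm := ⟨fun u v h ↦ ⟨h.1.symm, by rw [Finset.pair_comm]; exact h.2⟩⟩ }
  have hH : H.IsMatching := by
    rintro v ⟨a, ha, hva⟩
    have hex : ∃ w, H.Adj v w := by
      obtain ⟨x, y, hxy, rfl⟩ := hM a ha
      simp only [Finset.mem_insert, Finset.mem_singleton, f.injective.eq_iff] at hva
      obtain rfl | rfl := hva
      · exact ⟨y, hxy, ha⟩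
      · exact ⟨x, hxy.symm, by rwa [Finset.pair_comm]⟩
    obtain ⟨w, hw⟩ := hex
    refine ⟨w, hw, fun y hy ↦ ?_⟩
    have heq : ({f v, f y} : Finset ℕ) = {f v, f w} := by
      by_contra hne
      have hdis : Disjoint ({f v, f y} : Finset ℕ) {f v, f w} := hd hy.2 hw.2 hne
      simp at hdis
    have hmem : f y ∈ ({f v, f w} : Finset ℕ) := heq ▸ by simp
    simp only [Finset.mem_insert, Finset.mem_singleton, f.injective.eq_iff] at hmem
    exact hmem.resolve_left hy.1.ne'
  refine le_trans ?_ (hnu H hH)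
  have hsub : (M : Set (Finset ℕ)) ⊆ (fun e : Sym2 V ↦ (e.map f).toFinset) '' H.edgeSet := by
    intro a ha
    obtain ⟨u, v, huv, rfl⟩ := hM a ha
    exact ⟨s(u, v), ⟨huv, ha⟩, by simp [Sym2.toFinset_mk_eq]⟩
  rw [← Set.ncard_coe_finset]
  exact (Set.ncard_le_ncard hsub).trans (Set.ncard_image_le)

/-- Erdős–Gallai. If `G` is a graph on `n` vertices with matching number
at most `k`, then `e(G) ≤ max { h₂(n,2k+1,0), h₂(n,2k+1,k) }`. -/
theorem statement6 {V : Type*} [Fintype V] (G : SimpleGraph V) (n k : ℕ)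
    (hcard : Fintype.card V = n)
    (hnu : ∀ M : G.Subgraph, M.IsMatching → M.edgeSet.ncard ≤ k) :
    (G.edgeSet.ncard : ℤ) ≤ max (hr 2 n (2 * k + 1) 0) (hr 2 n (2 * k + 1) k) := by
  classical
  obtain ⟨f, hf⟩ : ∃ f : V ↪ ℕ, ∀ v, f v < n :=
    ⟨(Fintype.equivFinOfCardEq hcard).toEmbedding.trans Fin.valEmbedding, fun v ↦ by simp⟩
  let 𝒜 := ((Finset.range n).powersetCard 2).filter
    fun a ↦ ∃ u v, G.Adj u v ∧ {f u, f v} = a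
  have hinj : Function.Injective (fun e : Sym2 V ↦ (e.map f).toFinset) := by
    intro e e' h
    apply Sym2.map.injective f.injective
    ext x
    rw [← Sym2.mem_toFinset, ← Sym2.mem_toFinset]
    exact iff_of_eq (congrArg (x ∈ ·) h)
  have hcardG : G.edgeSet.ncard ≤ 𝒜.card := by
    rw [← Set.ncard_coe_finset]
    refine Set.ncard_le_ncard_of_injOn (fun e : Sym2 V ↦ (e.map f).toFinset) ?_ hinj.injOn
    intro e
    induction e with
    | _ u v =>
      intro huv
      have huv : G.Adj u v := huv
      simp only [𝒜, Sym2.map_mk, Sym2.toFinset_mk_eq, Finset.coe_filter, Set.mem_ofPred_eq,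
        Finset.mem_powersetCard]
      refine ⟨⟨?_, Finset.card_pair (f.injective.ne huv.ne)⟩, u, v, huv, rfl⟩
      simp [Finset.insert_subset_iff, hf]
  obtain hn | hn := le_or_gt n (2 * k + 1)
  · refine le_max_of_le_left ?_
    have h1 : 𝒜.card ≤ n.choose 2 :=
      (Finset.card_filter_le _ _).trans (by simp)
    have h2 : G.edgeSet.ncard ≤ (2 * k + 1).choose 2 :=
      hcardG.trans (h1.trans (Nat.choose_le_choose 2 hn))
    simpa [hr] using h2
  · obtain ⟨t, htk, ht⟩ := exists_card_le_of_matching_le (k := k) 𝒜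
      (Finset.filter_subset _ _) fun M hM hd ↦
        card_le_of_pairwiseDisjoint hnu f (fun a ha ↦ (Finset.mem_filter.1 (hM ha)).2) hd
    refine le_trans ?_ (hr_two_le_max htk)
    have h := hcardG.trans ht
    zify [show 2 * k + 1 - t ≤ n by omega, show t ≤ 2 * k + 1 by omega] at h
    simp only [hr, Nat.add_one_sub_one, Nat.choose_one_right]
    push_cast
    linarith
end

section
/- Let r ≥ 2 and let G be a graph on n ≥ 2k+2 vertices whose minimum degree equals d and whose matching number satisfies ν(G) ≤ k. Then N_r(G) ≤ max{ h_r(n, 2k+1, d), h_r(n, 2k+1, k) }. -/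
open SimpleGraph

theorem le_max_of_convex {f : ℕ → ℤ} {d s k : ℕ}
    (hf : ∀ i, i + 2 ≤ k → 2 * f (i + 1) ≤ f i + f (i + 2)) (hds : d ≤ s) (hsk : s ≤ k) :
    f s ≤ max (f d) (f k) := by
  have hmono : ∀ i j, i ≤ j → j + 1 ≤ k → f (i + 1) - f i ≤ f (j + 1) - f j := by
    intro i j hij
    induction j, hij using Nat.le_induction with
    | base => intro _; rfl
    | succ j _ ih =>
      intro hj
      have := ih (by omega)
      have := hf j hj
      linarith
  rcases hsk.eq_or_lt with rfl | hlt
  · exact le_max_right _ _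
  rcases le_total (f s) (f (s + 1)) with hs | hs
  · refine le_max_of_le_right ?_
    have key : ∀ j, s ≤ j → j ≤ k → f s ≤ f j := by
      intro j hsj
      induction j, hsj using Nat.le_induction with
      | base => intro _; rfl
      | succ j hsj ih =>
        intro hj
        have := ih (by omega)
        have := hmono s j hsj hj
        linarith
    exact key k hsk le_rfl
  · refine le_max_of_le_left ?_
    have key : ∀ j, d ≤ j → j ≤ s → f j ≤ f d := by
      intro j hdj
      induction j, hdj using Nat.le_induction with
      | base => intro _; rfl
      | succ j hdj ih =>
        intro hj
        have := ih (by omega)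
        have := hmono j s (by omega) (by omega)
        linarith
    exact key s hds le_rfl

theorem hr_le_max {r n K d s k : ℕ} (hr2 : 2 ≤ r) (hn : K ≤ n) (hkK : k ≤ K) (hds : d ≤ s)
    (hsk : s ≤ k) : hr r n K s ≤ max (hr r n K d) (hr r n K k) := by
  refine le_max_of_convex (fun i hi => ?_) hds hsk
  obtain ⟨p, rfl⟩ := Nat.exists_eq_add_of_le' hr2
  obtain ⟨e, rfl⟩ := Nat.exists_eq_add_of_le (hi.trans hkK)
  obtain ⟨N, rfl⟩ := Nat.exists_eq_add_of_le hn
  have h1 : i + 2 + e - (i + 1) = e + 1 := by omega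
  have h2 : i + 2 + e - i = e + 2 := by omega
  have h3 : i + 2 + e - (i + 2) = e := by omega
  have h4 : p + 2 - 1 = p + 1 := rfl
  simp only [hr, h1, h2, h3, h4]
  have e1 : (e + 1).choose (p + 2) = e.choose (p + 1) + e.choose (p + 2) :=
    Nat.choose_succ_succ' ..
  have e2 : (e + 2).choose (p + 2) = (e + 1).choose (p + 1) + (e + 1).choose (p + 2) :=
    Nat.choose_succ_succ' ..
  have i1 : (i + 1).choose (p + 1) = i.choose p + i.choose (p + 1) := Nat.choose_succ_succ' ..
  have i2 : (i + 2).choose (p + 1) = (i + 1).choose p + (i + 1).choose (p + 1) :=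
    Nat.choose_succ_succ' ..
  have e3 : e.choose (p + 1) ≤ (e + 1).choose (p + 1) := Nat.choose_le_choose _ (Nat.le_succ e)
  have i3 : i.choose p ≤ (i + 1).choose p := Nat.choose_le_choose _ (Nat.le_succ i)
  rw [i2, i1, e2, e1]
  push_cast
  zify at e3 i3
  nlinarith [mul_nonneg (add_nonneg (Int.natCast_nonneg N) (Int.natCast_nonneg i))
    (sub_nonneg.2 i3)]

theorem choose_add_le {a t D p : ℕ} (h : a + t ≤ D + 1) :
    (a + t).choose (p + 1) ≤ a.choose (p + 1) + t * D.choose p := by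
  induction t with
  | zero => simp
  | succ t ih =>
    have h1 := ih (by omega)
    have h2 : (a + t).choose p ≤ D.choose p := Nat.choose_le_choose _ (by omega)
    rw [← add_assoc, Nat.choose_succ_succ', add_mul]
    omega

theorem le_choose_add {a t D p : ℕ} (h : D ≤ a) :
    a.choose (p + 1) + t * D.choose p ≤ (a + t).choose (p + 1) := by
  induction t with
  | zero => simp
  | succ t ih =>
    have h2 : D.choose p ≤ (a + t).choose p := Nat.choose_le_choose _ (by omega)
    rw [← add_assoc, Nat.choose_succ_succ', add_mul]
    omega

theorem choose_add_choose_le (p x y r : ℕ) :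
    (p + x).choose r + (p + y).choose r ≤ (p + (x + y)).choose r + p.choose r := by
  induction y with
  | zero => simp
  | succ y ih =>
    rcases r with _ | r
    · simp
    have h : (p + y).choose r ≤ (p + (x + y)).choose r := Nat.choose_le_choose _ (by omega)
    rw [← add_assoc p y, ← add_assoc x y, ← add_assoc p (x + y), Nat.choose_succ_succ' (p + y),
      Nat.choose_succ_succ' (p + (x + y))]
    omega

theorem sum_choose_add_le {ι : Type*} (p r : ℕ) (I : Finset ι) (hI : I.Nonempty) (x : ι → ℕ) :
    ∑ i ∈ I, (p + x i).choose r + p.choose r ≤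
      (p + ∑ i ∈ I, x i).choose r + I.card * p.choose r := by
  induction hI using Finset.Nonempty.cons_induction with
  | singleton i => simp
  | cons i I hi _ ih =>
    rw [Finset.sum_cons, Finset.sum_cons, Finset.card_cons, add_mul]
    have := choose_add_choose_le p (x i) (∑ i ∈ I, x i) r
    omega

theorem ncard_verts_le_two_mul {V : Type*} [Finite V] {G : SimpleGraph V} {M : G.Subgraph}
    (h : M.IsMatching) : M.verts.ncard ≤ 2 * M.edgeSet.ncard := by
  classical
  have := Fintype.ofFinite V
  rw [Set.ncard_eq_toFinset_card' M.edgeSet, Set.ncard_eq_toFinset_card' M.verts, mul_comm]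
  have hsub : M.verts.toFinset ⊆ M.edgeSet.toFinset.biUnion Sym2.toFinset := by
    intro v hv
    obtain ⟨w, hw, _⟩ := h (Set.mem_toFinset.1 hv)
    simp only [Finset.mem_biUnion, Set.mem_toFinset, Sym2.mem_toFinset]
    exact ⟨s(v, w), hw, Sym2.mem_mk_left v w⟩
  exact (Finset.card_le_card hsub).trans <| Finset.card_biUnion_le_card_mul _ _ _
    fun e _ => by rw [Sym2.card_toFinset]; split <;> omega

/-- The join of `G` with the complete graph on `W`. -/
def joinTop {V : Type*} (G : SimpleGraph V) (W : Type*) : SimpleGraph (V ⊕ W) where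
  Adj
    | .inl u, .inl v => G.Adj u v
    | x, y => x ≠ y
  symm := ⟨by rintro (u | u) (v | v) h <;> simp_all [G.adj_comm, eq_comm]⟩
  loopless := ⟨by rintro (u | u) h <;> simp_all⟩

theorem joinTop_adj_inl {V W : Type*} {G : SimpleGraph V} {u v : V} :
    (joinTop G W).Adj (.inl u) (.inl v) ↔ G.Adj u v := Iff.rfl

theorem joinTop_adj_inr {V W : Type*} {G : SimpleGraph V} {x : V ⊕ W} {w : W}
    (h : x ≠ .inr w) : (joinTop G W).Adj x (.inr w) := by
  rcases x with x | x
  · exact h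
  · exact h

theorem exists_isMatching_of_joinTop {V W : Type*} [Finite V] [Finite W] {G : SimpleGraph V}
    {M : (joinTop G W).Subgraph} (hM : M.IsPerfectMatching) :
    ∃ M' : G.Subgraph, M'.IsMatching ∧ Nat.card V ≤ 2 * M'.edgeSet.ncard + Nat.card W := by
  classical
  let M' : G.Subgraph :=
    { verts := {v | ∃ w, M.Adj (.inl v) (.inl w)}
      Adj := fun u v => M.Adj (.inl u) (.inl v)
      adj_sub := fun h => joinTop_adj_inl.1 h.adj_sub
      edge_vert := fun h => ⟨_, h⟩
      symm := ⟨fun _ _ h => h.symm⟩ }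
  have hM' : M'.IsMatching := fun v ⟨w, hw⟩ =>
    ⟨w, hw, fun y hy => Sum.inl_injective (hM.1.eq_of_adj_left hy hw)⟩
  refine ⟨M', hM', ?_⟩
  have hex : ∀ v : V, v ∈ M'.vertsᶜ → ∃ w : W, M.Adj (.inl v) (.inr w) := by
    intro v hv
    obtain ⟨w | w, hw, -⟩ := hM.1 (hM.2 (.inl v))
    · exact absurd ⟨w, hw⟩ hv
    · exact ⟨w, hw⟩
  have hcompl : M'.vertsᶜ.ncard ≤ Nat.card W := by
    choose g hg using hex
    rw [← Nat.card_coe_set_eq]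
    refine Nat.card_le_card_of_injective (fun v : ↥(M'.vertsᶜ) => g v v.2) fun u v huv => ?_
    have h1 := hg u u.2
    rw [show g u u.2 = g v v.2 from huv] at h1
    exact Subtype.ext (Sum.inl_injective (hM.1.eq_of_adj_right h1 (hg v v.2)))
  have := ncard_verts_le_two_mul hM'
  have := Set.ncard_add_ncard_compl M'.verts
  omega

/-- Adding the right number of universal vertices turns Tutte's theorem into one inequality
of the Tutte-Berge formula. -/
theorem exists_set_coloring.{u} {V : Type u} [Fintype V] [DecidableEq V] (G : SimpleGraph V) (k : ℕ)
    (hn : 2 * k + 2 ≤ Fintype.card V)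
    (hnu : ∀ M : G.Subgraph, M.IsMatching → M.edgeSet.ncard ≤ k) :
    ∃ (S : Finset V) (ι : Type u) (_ : DecidableEq ι) (c : V → ι),
      (∀ u v, u ∉ S → v ∉ S → G.Adj u v → c u = c v) ∧
      S.card + Fintype.card V ≤ 2 * k + (Sᶜ.image c).card := by
  classical
  let m := Fintype.card V - (2 * k + 2)
  let H := joinTop G (Fin m)
  have hno : ¬ ∃ M : H.Subgraph, M.IsPerfectMatching := by
    rintro ⟨M, hM⟩
    obtain ⟨M', hM', hle⟩ := exists_isMatching_of_joinTop hM
    have := hnu M' hM'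
    simp only [Nat.card_eq_fintype_card, Fintype.card_fin, m] at hle
    omega
  rw [tutte] at hno
  push Not at hno
  obtain ⟨T, hT⟩ := hno
  let K := ((⊤ : H.Subgraph).deleteVerts T).coe
  have hK : K = ((⊤ : H.Subgraph).deleteVerts T).coe := rfl
  have hT' : T.ncard < K.oddComponents.ncard := hT
  have hadj : ∀ x y (hx : x ∉ T) (hy : y ∉ T), H.Adj x y →
      K.Adj ⟨x, by simpa using hx⟩ ⟨y, by simpa using hy⟩ := by
    intro x y hx hy h
    simp [hK, hx, hy, h]
  have hVcard : Nat.card (V ⊕ Fin m) + 2 * k + 2 = 2 * Fintype.card V := by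
    simp [m]; omega
  have hverts : T.ncard + Nat.card ((⊤ : H.Subgraph).deleteVerts T).verts =
      Nat.card (V ⊕ Fin m) := by
    rw [← Set.ncard_add_ncard_compl T, Nat.card_coe_set_eq]
    simp [Set.compl_eq_univ_sdiff]
  have hpar := K.odd_ncard_oddComponents
  have htwo : T.ncard + 2 ≤ K.oddComponents.ncard := by
    rw [Nat.odd_iff, Nat.odd_iff] at hpar
    omega
  have hle : K.oddComponents.ncard ≤ Nat.card K.ConnectedComponent := by
    rw [← Set.ncard_univ]
    exact Set.ncard_le_ncard (Set.subset_univ _)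
  have hinr : ∀ i, Sum.inr i ∈ T := by
    intro i
    by_contra hi
    have hsub : Subsingleton K.ConnectedComponent := by
      refine ⟨fun a b => ?_⟩
      have key : ∀ a, a = K.connectedComponentMk ⟨.inr i, by simpa using hi⟩ := by
        refine ConnectedComponent.ind fun ⟨x, hx⟩ => ?_
        have hx' : x ∉ T := by simpa using hx
        rw [ConnectedComponent.eq]
        by_cases hxi : x = .inr i
        · subst hxi; rfl
        · exact (hadj x _ hx' hi (joinTop_adj_inr hxi)).reachable
      rw [key a, key b]
    have := Finite.card_le_one_iff_subsingleton.2 hsub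
    omega
  let S : Finset V := Finset.univ.filter fun v => Sum.inl v ∈ T
  have hS : ∀ v, v ∉ S ↔ Sum.inl v ∉ T := by simp [S]
  let c : V → Option K.ConnectedComponent := fun v =>
    if h : Sum.inl v ∈ T then none else some (K.connectedComponentMk ⟨.inl v, by simpa using h⟩)
  refine ⟨S, _, inferInstance, c, fun u v hu hv huv => ?_, ?_⟩
  · rw [hS] at hu hv
    simp only [c, hu, hv, dite_false, Option.some.injEq, ConnectedComponent.eq]
    exact (hadj _ _ hu hv huv).reachable
  · have hST : S.card + m ≤ T.ncard := by
      have hsub : S.disjSum (Finset.univ : Finset (Fin m)) ⊆ T.toFinset := by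
        rintro (v | i) hx
        · simpa [S] using hx
        · simpa using hinr i
      have := Finset.card_le_card hsub
      simpa [Set.ncard_eq_toFinset_card'] using this
    have hcomp : Nat.card K.ConnectedComponent ≤ (Sᶜ.image c).card := by
      have : Fintype K.ConnectedComponent := Fintype.ofFinite _
      rw [Nat.card_eq_fintype_card, ← Finset.card_univ]
      refine Finset.card_le_card_of_injOn some (fun a _ => ?_) (Option.some_injective _).injOn
      induction a using ConnectedComponent.ind with
      | h x =>
        obtain ⟨v | i, hx⟩ := x
        · have hv : Sum.inl v ∉ T := by simpa using hx
          simp only [Finset.coe_image, Set.mem_image, Finset.mem_coe, Finset.mem_compl, hS]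
          exact ⟨v, hv, by simp [c, hv]⟩
        · exact absurd (hinr i) (by simpa using hx)
    omega

theorem card_cliqueFinset_le {V ι : Type*} [Fintype V] [DecidableEq V] [DecidableEq ι]
    (G : SimpleGraph V) [DecidableRel G.Adj] (r : ℕ) (S : Finset V) (c : V → ι)
    (hc : ∀ u v, u ∉ S → v ∉ S → G.Adj u v → c u = c v) :
    (G.cliqueFinset r).card ≤ S.card.choose r + ∑ i ∈ Sᶜ.image c,
      ((S.card + {v ∈ Sᶜ | c v = i}.card).choose r - S.card.choose r) := by
  have hsub : G.cliqueFinset r ⊆ S.powersetCard r ∪ (Sᶜ.image c).biUnion fun i =>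
      (S ∪ {v ∈ Sᶜ | c v = i}).powersetCard r \ S.powersetCard r := by
    intro s hs
    rw [mem_cliqueFinset_iff] at hs
    by_cases hsS : s ⊆ S
    · exact Finset.mem_union_left _ (Finset.mem_powersetCard.2 ⟨hsS, hs.card_eq⟩)
    · obtain ⟨u, hus, huS⟩ := Finset.not_subset.1 hsS
      refine Finset.mem_union_right _ (Finset.mem_biUnion.2
        ⟨c u, Finset.mem_image_of_mem _ (Finset.mem_compl.2 huS), ?_⟩)
      simp only [Finset.mem_sdiff, Finset.mem_powersetCard, hs.card_eq, hsS, and_true,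
        not_false_eq_true]
      intro v hv
      by_cases hvS : v ∈ S
      · exact Finset.mem_union_left _ hvS
      · refine Finset.mem_union_right _ ?_
        simp only [Finset.mem_filter, Finset.mem_compl, hvS, not_false_eq_true, true_and]
        by_cases huv : v = u
        · rw [huv]
        · exact hc v u hvS huS (hs.isClique hv hus huv)
  refine (Finset.card_le_card hsub).trans ((Finset.card_union_le _ _).trans ?_)
  rw [Finset.card_powersetCard]
  refine Nat.add_le_add_left (Finset.card_biUnion_le.trans (Finset.sum_le_sum fun i _ => ?_)) _
  rw [Finset.card_sdiff_of_subset (Finset.powersetCard_mono Finset.subset_union_left),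
    Finset.card_powersetCard, Finset.card_powersetCard, Finset.card_union_of_disjoint]
  exact (disjoint_compl_right (a := S)).mono_right (Finset.filter_subset _ _)

/-- Duan et al.. If `G` is a graph on `n ≥ 2k+2` vertices with minimum degree
equal to `d` and matching number at most `k`, and `r ≥ 2`, then
`Nᵣ(G) ≤ max { hᵣ(n,2k+1,d), hᵣ(n,2k+1,k) }`. -/
theorem statement7 {V : Type*} [Fintype V] (G : SimpleGraph V) (n k d r : ℕ)
    (hcard : Fintype.card V = n) (hn : 2 * k + 2 ≤ n) (hr2 : 2 ≤ r)
    (hmin : IsLeast (Set.range (degN G)) d)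
    (hnu : ∀ M : G.Subgraph, M.IsMatching → M.edgeSet.ncard ≤ k) :
    (Nr r G : ℤ) ≤ max (hr r n (2 * k + 1) d) (hr r n (2 * k + 1) k) := by
  classical
  subst hcard
  obtain ⟨S, ι, _, c, hc, hS⟩ := exists_set_coloring G k hn hnu
  have hN := card_cliqueFinset_le G r S c hc
  have hNr : Nr r G = (G.cliqueFinset r).card := by
    rw [Nr, ← Set.ncard_coe_finset, coe_cliqueFinset]; rfl
  rw [← hNr] at hN
  set I := Sᶜ.image c with hI
  set s := S.card
  let N : ι → ℕ := fun i => {v ∈ Sᶜ | c v = i}.card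
  have hNsum : ∑ i ∈ I, N i + s = Fintype.card V := by
    have := Finset.card_eq_sum_card_image c Sᶜ
    rw [← S.card_compl_add_card, this]
  have hNpos : ∀ i ∈ I, 1 ≤ N i ∧ d + 1 ≤ s + N i := by
    intro i hi
    obtain ⟨v, hv, rfl⟩ := Finset.mem_image.1 hi
    have hvN : v ∈ {w ∈ Sᶜ | c w = c v} := by simpa using hv
    refine ⟨Finset.card_pos.2 ⟨v, hvN⟩, ?_⟩
    have hd : d ≤ G.degree v := by
      have := hmin.2 ⟨v, rfl⟩
      rwa [degN, Set.ncard_eq_toFinset_card', ← neighborFinset_def, card_neighborFinset_eq_degree]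
        at this
    have hsub : insert v (G.neighborFinset v) ⊆ S ∪ {w ∈ Sᶜ | c w = c v} := by
      intro w hw
      rcases Finset.mem_insert.1 hw with rfl | hw
      · exact Finset.mem_union_right _ hvN
      · by_cases hwS : w ∈ S
        · exact Finset.mem_union_left _ hwS
        · refine Finset.mem_union_right _ ?_
          simp only [Finset.mem_filter, Finset.mem_compl, hwS, not_false_eq_true, true_and]
          exact hc w v hwS (Finset.mem_compl.1 hv) ((G.mem_neighborFinset v w).1 hw).symm
    have := (Finset.card_le_card hsub).trans (Finset.card_union_le _ _)
    rw [Finset.card_insert_of_notMem (by simp), card_neighborFinset_eq_degree] at this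
    exact (Nat.succ_le_succ hd).trans this
  set D := max s d
  obtain ⟨t, ht⟩ : ∃ t, D + 1 = s + t := Nat.exists_eq_add_of_le (by omega)
  have htN : ∀ i ∈ I, t ≤ N i := fun i hi => by
    have := hNpos i hi
    omega
  have hIne : I.Nonempty := Finset.card_pos.1 (by omega)
  obtain ⟨q, hq⟩ : ∃ q, I.card = q + 1 := Nat.exists_eq_add_of_le' (Finset.card_pos.2 hIne)
  obtain ⟨p, rfl⟩ := Nat.exists_eq_add_of_le' (one_le_two.trans hr2)
  have hsum : ∑ i ∈ I, (N i - t) + (q + 1) * t = ∑ i ∈ I, N i := by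
    rw [← hq, ← smul_eq_mul, ← Finset.sum_const, ← Finset.sum_add_distrib]
    exact Finset.sum_congr rfl fun i hi => Nat.sub_add_cancel (htN i hi)
  have hconv := sum_choose_add_le (D + 1) (p + 1) I hIne fun i => N i - t
  have hterm : ∑ i ∈ I, ((s + N i).choose (p + 1) - s.choose (p + 1)) +
      (q + 1) * s.choose (p + 1) = ∑ i ∈ I, (D + 1 + (N i - t)).choose (p + 1) := by
    rw [← hq, ← smul_eq_mul, ← Finset.sum_const, ← Finset.sum_add_distrib]
    refine Finset.sum_congr rfl fun i hi => ?_
    have : D + 1 + (N i - t) = s + N i := by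
      have := htN i hi
      omega
    rw [this, Nat.sub_add_cancel (Nat.choose_le_choose _ (Nat.le_add_right _ _))]
  set m := D + 1 + ∑ i ∈ I, (N i - t) with hm
  have hsmall : (D + 1).choose (p + 1) ≤ s.choose (p + 1) + t * D.choose p :=
    ht ▸ choose_add_le ht.ge
  have hmn : m + q * t = Fintype.card V := by
    rw [hm, ht, ← hNsum, ← hsum]; ring
  have hNm : Nr (p + 1) G ≤ m.choose (p + 1) + q * (t * D.choose p) := by
    have := Nat.mul_le_mul_left q hsmall
    rw [hq] at hconv
    change _ ≤ _ + ∑ i ∈ I, ((s + N i).choose (p + 1) - s.choose (p + 1)) at hN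
    linarith
  have hqt : D ≤ s + (t - 1) * q := by
    have : (t - 1) * 1 ≤ (t - 1) * q := Nat.mul_le_mul_left _ (by omega)
    omega
  have htq : q * t = (t - 1) * q + q := by
    obtain ⟨u, rfl⟩ : ∃ u, t = u + 1 := Nat.exists_eq_add_of_le' (by omega)
    simp; ring
  obtain ⟨e, he⟩ : ∃ e, 2 * k + 1 - D = m + e := Nat.exists_eq_add_of_le (by omega)
  have hgrow : m.choose (p + 1) + e * D.choose p ≤ (m + e).choose (p + 1) :=
    le_choose_add (by omega)
  refine le_trans ?_ (hr_le_max hr2 (by omega) (by omega) (le_max_right s d) (by omega))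
  rw [hr, he, Nat.add_sub_cancel]
  have hcoef : ((Fintype.card V : ℕ) : ℤ) - (2 * k + 1 : ℕ) + (D : ℕ) = q * t - e := by
    zify at hmn
    omega
  rw [hcoef]
  zify at hgrow hNm
  linarith
end

section
/- Let G be a graph on n vertices and let u, v be non-adjacent vertices of G with d_G(u) + d_G(v) ≥ k. Then G is 𝓛_k-free if and only if the graph G + uv obtained by adding the edge uv is 𝓛_k-free. -/
open SimpleGraph

open Classical in
/-- The indicator of adjacency in `G`. -/
noncomputable def adjInd {V : Type*} (G : SimpleGraph V) (a b : V) : ℕ :=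
  if G.Adj a b then 1 else 0

/-- The number of consecutive pairs of a list that are adjacent in `G`. -/
noncomputable def linkCount {V : Type*} (G : SimpleGraph V) : List V → ℕ
  | [] => 0
  | [_] => 0
  | a :: b :: l => adjInd G a b + linkCount G (b :: l)

section LinkCount

variable {V : Type*} {G H : SimpleGraph V}

lemma adjInd_le_one (a b : V) : adjInd G a b ≤ 1 := by
  unfold adjInd; split_ifs <;> simp

lemma adjInd_eq_one {a b : V} (h : G.Adj a b) : adjInd G a b = 1 := by
  simp [adjInd, h]

lemma adjInd_eq_zero {a b : V} (h : ¬ G.Adj a b) : adjInd G a b = 0 := by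
  simp [adjInd, h]

lemma adjInd_comm (a b : V) : adjInd G a b = adjInd G b a := by
  by_cases h : G.Adj a b <;> simp [adjInd, h, G.adj_comm b a]

lemma adjInd_mono (h : G ≤ H) (a b : V) : adjInd G a b ≤ adjInd H a b := by
  by_cases hab : G.Adj a b
  · simp [adjInd, hab, h hab]
  · simp [adjInd, hab]

@[simp] lemma linkCount_nil : linkCount G [] = 0 := rfl

@[simp] lemma linkCount_singleton (a : V) : linkCount G [a] = 0 := rfl

@[simp] lemma linkCount_cons_cons (a b : V) (l : List V) :
    linkCount G (a :: b :: l) = adjInd G a b + linkCount G (b :: l) := rfl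

lemma linkCount_append_cons (l₁ : List V) (a : V) (l₂ : List V) :
    linkCount G (l₁ ++ a :: l₂) = linkCount G (l₁ ++ [a]) + linkCount G (a :: l₂) := by
  induction l₁ with
  | nil => simp
  | cons x l₁ ih =>
    cases l₁ with
    | nil => simp
    | cons y l₁ => simp only [List.cons_append, linkCount_cons_cons] at ih ⊢; omega

lemma linkCount_append_cons_cons (l₁ : List V) (a b : V) (l₂ : List V) :
    linkCount G (l₁ ++ a :: b :: l₂) =
      linkCount G (l₁ ++ [a]) + adjInd G a b + linkCount G (b :: l₂) := by
  rw [linkCount_append_cons, linkCount_cons_cons, add_assoc]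

lemma linkCount_reverse (l : List V) : linkCount G l.reverse = linkCount G l := by
  induction l with
  | nil => rfl
  | cons a l ih =>
    cases l with
    | nil => rfl
    | cons b l =>
      have h := linkCount_append_cons_cons (G := G) l.reverse b a []
      simp only [List.reverse_cons, List.append_assoc, List.cons_append, List.nil_append,
        linkCount_singleton, linkCount_cons_cons] at ih h ⊢
      rw [h, ih, adjInd_comm b a]
      omega

lemma linkCount_mono (h : G ≤ H) (l : List V) : linkCount G l ≤ linkCount H l := by
  induction l with
  | nil => simp
  | cons a l ih =>
    cases l with
    | nil => simp
    | cons b l => simpa using add_le_add (adjInd_mono h a b) ih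

lemma linkCount_le_append (l₁ l₂ : List V) :
    linkCount G l₁ + linkCount G l₂ ≤ linkCount G (l₁ ++ l₂) := by
  rcases l₁.eq_nil_or_concat' with rfl | ⟨l₁, a, rfl⟩
  · simp
  · cases l₂ with
    | nil => simp
    | cons b l₂ =>
      rw [List.append_assoc, List.singleton_append, linkCount_append_cons_cons]
      omega

lemma linkCount_le_erase_isolated {x : V} (hx : ∀ z, ¬ G.Adj x z) (l₁ l₂ : List V) :
    linkCount G (l₁ ++ x :: l₂) ≤ linkCount G (l₁ ++ l₂) := by
  refine le_trans ?_ (linkCount_le_append l₁ l₂)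
  have h₁ : linkCount G (l₁ ++ [x]) = linkCount G l₁ := by
    rcases l₁.eq_nil_or_concat' with rfl | ⟨l₁, a, rfl⟩
    · simp
    · rw [List.append_assoc, List.singleton_append, linkCount_append_cons_cons,
        adjInd_comm, adjInd_eq_zero (hx a)]
      simp
  have h₂ : linkCount G (x :: l₂) = linkCount G l₂ := by
    cases l₂ with
    | nil => simp
    | cons b l₂ => simp [adjInd_eq_zero (hx b)]
  rw [linkCount_append_cons, h₁, h₂]

lemma degN_eq_sum [Fintype V] (u : V) {l : List V} (hl : l.Nodup) (hmem : ∀ x, x ∈ l) :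
    degN G u = (l.map (adjInd G u)).sum := by
  classical
  rw [← List.sum_toFinset _ hl, show l.toFinset = Finset.univ by ext; simp [hmem]]
  unfold degN adjInd
  rw [Finset.sum_boole, Nat.cast_id, ← Set.ncard_coe_finset]
  congr 1
  ext
  simp

/-- An acyclic graph with an edge has a vertex with exactly one neighbor. -/
lemma SimpleGraph.IsAcyclic.exists_leaf [Fintype V] (hH : H.IsAcyclic) {a b : V}
    (hab : H.Adj a b) : ∃ x y, H.Adj x y ∧ ∀ z, H.Adj x z → z = y := by
  classical
  let P : ℕ → Prop := fun n => ∃ (x y : V) (p : H.Walk x y), p.IsPath ∧ p.length = n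
  have hP : P 1 := ⟨a, b, hab.toWalk, by simp [hab.ne], by simp⟩
  have hcard : 1 ≤ Fintype.card V := Fintype.card_pos_iff.mpr ⟨a⟩
  obtain ⟨x, y, p, hp, hlen⟩ := Nat.findGreatest_spec (P := P) hcard hP
  have hpos : 1 ≤ p.length := hlen ▸ Nat.le_findGreatest hcard hP
  refine ⟨x, p.snd, p.adj_snd (by rw [← SimpleGraph.Walk.length_eq_zero_iff.not]; omega),
    fun z hz => ?_⟩
  by_cases hzp : z ∈ p.support
  · exact hH.eq_snd_of_adj_start hp hz hzp
  · have hq : (SimpleGraph.Walk.cons hz.symm p).IsPath := hp.cons hzp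
    have := Nat.le_findGreatest (P := P) hq.length_lt.le ⟨_, _, _, hq, rfl⟩
    simp at this
    omega

lemma IsLinearForest.anti [Finite V] (hH : IsLinearForest H) (h : G ≤ H) : IsLinearForest G :=
  ⟨hH.1.anti h, fun v => le_trans (Set.ncard_le_ncard fun _ hx => h hx) (hH.2 v)⟩

/-- Every linear forest can be laid out along an ordering of the vertices. -/
lemma IsLinearForest.exists_list [Fintype V] (hH : IsLinearForest H) :
    ∃ l : List V, l.Nodup ∧ (∀ x, x ∈ l) ∧ H.edgeSet.ncard ≤ linkCount H l := by
  classical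
  induction hn : H.edgeSet.ncard generalizing H with
  | zero =>
    exact ⟨Finset.univ.toList, Finset.nodup_toList _, by simp, Nat.zero_le _⟩
  | succ n ih =>
    obtain ⟨e, he⟩ : H.edgeSet.Nonempty := by
      rw [← Set.ncard_pos]; omega
    induction e with | _ a b
    obtain ⟨x, y, hxy, hleaf⟩ := hH.1.exists_leaf he
    set H' := H.deleteEdges {s(x, y)} with hH'
    have hle : H' ≤ H := H.deleteEdges_le _
    have hcard : H'.edgeSet.ncard = n := by
      rw [hH', SimpleGraph.edgeSet_deleteEdges, Set.ncard_sdiff_singleton_of_mem (H.mem_edgeSet.mpr hxy), hn,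
        Nat.add_sub_cancel]
    obtain ⟨l, hnd, hmem, hl⟩ := ih (hH.anti hle) hcard
    have hiso : ∀ z, ¬ H'.Adj x z := by
      intro z hz
      rw [hH', SimpleGraph.deleteEdges_adj] at hz
      obtain rfl := hleaf z hz.1
      exact hz.2 rfl
    obtain ⟨A, B, rfl⟩ := List.append_of_mem (hmem x)
    have hAB := hl.trans (linkCount_le_erase_isolated hiso A B) |>.trans (linkCount_mono hle _)
    have hperm : (A ++ x :: B).Perm (x :: (A ++ B)) := List.perm_middle
    have hy : y ∈ A ++ B := by
      have := hperm.mem_iff.mp (hmem y)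
      simpa [hxy.ne'] using this
    obtain ⟨C, D, hCD⟩ := List.append_of_mem hy
    rw [hCD] at hperm hAB
    have hnd' : (x :: (C ++ y :: D)).Nodup := hperm.nodup_iff.mp hnd
    suffices h : ∃ l : List V, l.Perm (x :: (C ++ y :: D)) ∧
        linkCount H (C ++ y :: D) + 1 ≤ linkCount H l by
      obtain ⟨l, hlp, hlc⟩ := h
      exact ⟨l, hlp.nodup_iff.mpr hnd', fun z => (hlp.trans hperm.symm).mem_iff.mpr (hmem z),
        by omega⟩
    have hleft : (C = [] ∨ ∃ C' c, C = C' ++ [c] ∧ ¬ H.Adj c y) →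
        linkCount H (C ++ y :: D) + 1 ≤ linkCount H (C ++ x :: y :: D) := by
      rintro (rfl | ⟨C', c, rfl, hc⟩)
      · simp [adjInd_eq_one hxy, add_comm]
      · have h := linkCount_le_append (G := H) (C' ++ [c]) (x :: y :: D)
        rw [linkCount_cons_cons, adjInd_eq_one hxy] at h
        rw [List.append_assoc C' [c] (y :: D), List.singleton_append,
          linkCount_append_cons_cons, adjInd_eq_zero hc]
        omega
    have hright : (D = [] ∨ ∃ d D', D = d :: D' ∧ ¬ H.Adj y d) →
        linkCount H (C ++ y :: D) + 1 ≤ linkCount H (C ++ y :: x :: D) := by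
      have hyx := adjInd_eq_one hxy.symm
      rintro (rfl | ⟨d, D', rfl, hd⟩)
      · rw [linkCount_append_cons_cons, hyx]; simp
      · have h := linkCount_le_append (G := H) [x] (d :: D')
        rw [linkCount_append_cons_cons, linkCount_append_cons_cons, adjInd_eq_zero hd, hyx]
        simp only [List.singleton_append, linkCount_singleton] at h
        omega
    by_cases h₁ : C = [] ∨ ∃ C' c, C = C' ++ [c] ∧ ¬ H.Adj c y
    · exact ⟨_, List.perm_middle, hleft h₁⟩
    by_cases h₂ : D = [] ∨ ∃ d D', D = d :: D' ∧ ¬ H.Adj y d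
    · refine ⟨_, ?_, hright h₂⟩
      have : (C ++ y :: x :: D).Perm (C ++ x :: y :: D) := (List.Perm.swap x y D).append_left C
      exact this.trans List.perm_middle
    exfalso
    push Not at h₁ h₂
    obtain ⟨C', c, rfl⟩ := (List.eq_nil_or_concat' C).resolve_left h₁.1
    obtain ⟨d, D', rfl⟩ := List.exists_cons_of_ne_nil h₂.1
    have hc := h₁.2 C' c rfl
    have hd := h₂.2 d D' rfl
    have hthree : ({x, c, d} : Set V).ncard = 3 := by
      rw [Set.ncard_eq_three]
      refine ⟨x, c, d, ?_, ?_, ?_, rfl⟩ <;> rintro rfl <;> simp [List.nodup_append] at hnd'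
    have hsub : ({x, c, d} : Set V) ⊆ H.neighborSet y := by
      rintro z (rfl | rfl | rfl)
      exacts [hxy.symm, hc.symm, hd]
    have := Set.ncard_le_ncard hsub
    have := hH.2 y
    unfold degN at this
    omega

/-- The consecutive adjacent pairs of a list without repetitions form a linear forest. -/
lemma exists_isLinearForest_of_nodup [Finite V] (l : List V) (hl : l.Nodup) :
    ∃ H ≤ G, IsLinearForest H ∧ H.edgeSet.ncard = linkCount G l ∧
      (∀ x y, H.Adj x y → x ∈ l) ∧ ∀ a, l.head? = some a → degN H a ≤ 1 := by
  induction l with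
  | nil => exact ⟨⊥, bot_le, ⟨by simp, by simp [degN]⟩, by simp, by simp, by simp⟩
  | cons a l ih =>
    obtain ⟨ha, hl⟩ := List.nodup_cons.mp hl
    obtain ⟨H, hHG, hH, hcard, hsupp, hhead⟩ := ih hl
    have hiso : ∀ z, ¬ H.Adj a z := fun z hz => ha (hsupp a z hz)
    have hnbr : H.neighborSet a = ∅ := by ext z; simp [hiso z]
    rcases l with _ | ⟨b, l⟩
    · refine ⟨H, hHG, hH, hcard, fun x y h => by simp at hsupp; exact (hsupp x y h).elim, ?_⟩
      simp [degN, hnbr]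
    by_cases hab : G.Adj a b
    · have hdeg : ∀ x, x ≠ a → x ≠ b →
          (H ⊔ SimpleGraph.fromEdgeSet {s(a, b)}).neighborSet x = H.neighborSet x := by
        intro x hxa hxb
        ext z
        simp [hxa, hxb]
      have hdega : (H ⊔ SimpleGraph.fromEdgeSet {s(a, b)}).neighborSet a = {b} := by
        ext z
        have := hiso z
        have := hab.ne
        simp only [SimpleGraph.mem_neighborSet, SimpleGraph.sup_adj,
          SimpleGraph.fromEdgeSet_adj, Set.mem_singleton_iff, Sym2.eq_iff]
        grind
      have hdegb : (H ⊔ SimpleGraph.fromEdgeSet {s(a, b)}).neighborSet b =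
          insert a (H.neighborSet b) := by
        ext z
        have := hab.ne
        simp only [SimpleGraph.mem_neighborSet, SimpleGraph.sup_adj,
          SimpleGraph.fromEdgeSet_adj, Set.mem_singleton_iff, Sym2.eq_iff, Set.mem_insert_iff]
        grind
      refine ⟨H ⊔ SimpleGraph.fromEdgeSet {s(a, b)}, ?_, ⟨?_, ?_⟩, ?_, ?_, ?_⟩
      · refine sup_le hHG ?_
        rw [SimpleGraph.fromEdgeSet_le]
        rintro e ⟨rfl, -⟩
        exact hab
      · exact (SimpleGraph.isAcyclic_add_edge_iff_of_not_reachable a b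
          (SimpleGraph.not_reachable_of_neighborSet_left_eq_empty hab.ne hnbr)).mpr hH.1
      · intro x
        by_cases hxa : x = a
        · subst hxa; simp [degN, hdega]
        by_cases hxb : x = b
        · subst hxb
          have := hhead x rfl
          unfold degN at this ⊢
          rw [hdegb]
          exact (Set.ncard_insert_le _ _).trans (by omega)
        · simpa [degN, hdeg x hxa hxb] using hH.2 x
      · rw [SimpleGraph.edgeSet_sup, SimpleGraph.edgeSet_fromEdgeSet,
          show ({s(a, b)} : Set (Sym2 V)) \ Sym2.diagSet = {s(a, b)} by
            ext e; simp; rintro rfl; simpa using hab.ne,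
          Set.union_singleton, Set.ncard_insert_of_notMem (by simpa using hiso b), hcard,
          linkCount_cons_cons, adjInd_eq_one hab, add_comm]
      · intro x y h
        simp only [SimpleGraph.sup_adj, SimpleGraph.fromEdgeSet_adj, Set.mem_singleton_iff,
          Sym2.eq_iff] at h
        have := hsupp x y
        grind
      · intro x hx
        obtain rfl : a = x := by simpa using hx
        simp [degN, hdega]
    · refine ⟨H, hHG, hH, by simp [hcard, adjInd_eq_zero hab],
        fun x y h => List.mem_cons_of_mem _ (hsupp x y h), ?_⟩
      intro x hx
      obtain rfl : a = x := by simpa using hx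
      simp [degN, hnbr]

lemma LinearForestFree.linkCount_lt [Finite V] {k : ℕ} (hG : LinearForestFree k G)
    {l : List V} (hl : l.Nodup) : linkCount G l < k := by
  by_contra! hk
  obtain ⟨H, hHG, hH, hcard, -⟩ := exists_isLinearForest_of_nodup (G := G) l hl
  obtain ⟨S, hS, hSk⟩ := Set.exists_subset_card_eq (hcard ▸ hk)
  have hle : SimpleGraph.fromEdgeSet S ≤ H := by
    rw [SimpleGraph.fromEdgeSet_le]
    exact Set.sdiff_subset.trans hS
  refine hG _ (hle.trans hHG) (hH.anti hle) ?_
  rw [SimpleGraph.edgeSet_fromEdgeSet, ← hSk]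
  congr 1
  ext e
  simp only [Set.mem_sdiff, and_iff_left_iff_imp]
  exact fun he => H.not_isDiag_of_mem_edgeSet (hS he)

lemma adjInd_add_edge_of_ne {u v a b : V} (h : s(a, b) ≠ s(u, v)) :
    adjInd (G ⊔ SimpleGraph.fromEdgeSet {s(u, v)}) a b = adjInd G a b := by
  have : (G ⊔ SimpleGraph.fromEdgeSet {s(u, v)}).Adj a b ↔ G.Adj a b := by
    simp only [SimpleGraph.sup_adj, SimpleGraph.fromEdgeSet_adj, Set.mem_singleton_iff, h,
      false_and, or_false]
  by_cases hab : G.Adj a b <;> simp only [adjInd, this, hab, if_true, if_false]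

lemma linkCount_add_edge_of_notMem {u v : V} {l : List V} (h : u ∉ l ∨ v ∉ l) :
    linkCount (G ⊔ SimpleGraph.fromEdgeSet {s(u, v)}) l = linkCount G l := by
  induction l with
  | nil => rfl
  | cons a l ih =>
    cases l with
    | nil => rfl
    | cons b l =>
      rw [linkCount_cons_cons, linkCount_cons_cons, ih (by simp at h ⊢; tauto),
        adjInd_add_edge_of_ne]
      rw [Ne, Sym2.eq_iff]
      simp at h
      grind

lemma linkCount_add_edge_le_or_exists (u v : V) (l : List V) :
    linkCount (G ⊔ SimpleGraph.fromEdgeSet {s(u, v)}) l ≤ linkCount G l ∨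
      ∃ A B, l = A ++ u :: v :: B ∨ l = A ++ v :: u :: B := by
  induction l with
  | nil => simp
  | cons a l ih =>
    cases l with
    | nil => simp
    | cons b l =>
      by_cases hab : s(a, b) = s(u, v)
      · right
        refine ⟨[], l, ?_⟩
        rw [Sym2.eq_iff] at hab
        grind
      · rcases ih with ih | ⟨A, B, h⟩
        · left
          simpa [adjInd_add_edge_of_ne hab] using ih
        · right
          refine ⟨a :: A, B, ?_⟩
          simpa using h

lemma sum_adjInd_add_sum_adjInd_tail_le {u v : V} (x : V) (l : List V)
    (hsplit : ∀ X a b Y, x :: l = X ++ a :: b :: Y → adjInd G u a + adjInd G v b ≤ adjInd G a b)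
    (hlast : ∀ X a, x :: l = X ++ [a] → ¬ G.Adj u a) :
    ((x :: l).map (adjInd G u)).sum + (l.map (adjInd G v)).sum ≤ linkCount G (x :: l) := by
  induction l generalizing x with
  | nil => simp [adjInd_eq_zero (hlast [] x rfl)]
  | cons y l ih =>
    have h₁ := hsplit [] x y l rfl
    have h₂ := ih y (fun X a b Y h => hsplit (x :: X) a b Y (by simp [h]))
      (fun X a h => hlast (x :: X) a (by simp [h]))
    simp only [List.map_cons, List.sum_cons, linkCount_cons_cons] at h₂ ⊢
    omega

lemma sum_adjInd_add_sum_adjInd_le {u v : V} (l : List V)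
    (hsplit : ∀ X a b Y, l = X ++ a :: b :: Y → adjInd G u a + adjInd G v b ≤ adjInd G a b)
    (hlast : ∀ X a, l = X ++ [a] → ¬ G.Adj u a) (hhead : ∀ a X, l = a :: X → ¬ G.Adj v a) :
    (l.map (adjInd G u)).sum + (l.map (adjInd G v)).sum ≤ linkCount G l := by
  cases l with
  | nil => simp
  | cons x l =>
    have := sum_adjInd_add_sum_adjInd_tail_le x l hsplit hlast
    simpa [adjInd_eq_zero (hhead x l rfl)] using this

/-- Reversing a final segment of the part before `u`, in an ordering where `u`, `v` are
consecutive, bounds the number of neighbors of `u` and `v` in that part. -/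
lemma sum_adjInd_left_le {k : ℕ} {u v : V} {A B : List V}
    (hG : ∀ l : List V, l.Perm (A ++ u :: v :: B) → linkCount G l < k)
    (hk : k ≤ linkCount G (A ++ [u]) + linkCount G (v :: B) + 1) :
    ((A ++ [u]).map (adjInd G u)).sum + ((A ++ [u]).map (adjInd G v)).sum ≤
      linkCount G (A ++ [u]) := by
  have happ : A ++ u :: v :: B = (A ++ [u]) ++ v :: B := by simp
  rw [happ] at hG
  refine sum_adjInd_add_sum_adjInd_le _ (fun X a b Y h => ?_) (fun X a h => ?_)
    (fun a X h hva => ?_)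
  · obtain ⟨Z, hZ⟩ : ∃ Z, b :: Y = Z ++ [u] := by
      rcases List.eq_nil_or_concat' (b :: Y) with h' | ⟨Z, c, h'⟩
      · simp at h'
      · rw [h', ← List.cons_append, ← List.append_assoc] at h
        obtain rfl : u = c := by simpa using (List.append_inj' h rfl).2
        exact ⟨Z, h'⟩
    have hrev : u :: (Z.reverse ++ v :: B) = Y.reverse ++ b :: v :: B := by
      have := congrArg (· ++ v :: B) (congrArg List.reverse hZ)
      simpa using this.symm
    have h₁ := hG (X ++ a :: u :: (Z.reverse ++ v :: B)) (by
      rw [h, hrev, show Y.reverse ++ b :: v :: B = (b :: Y).reverse ++ v :: B by simp,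
        List.append_assoc]
      exact (((List.reverse_perm _).append_right _).cons _).append_left _)
    have h₂ : linkCount G (Y.reverse ++ [b]) = linkCount G (b :: Y) := by
      rw [← List.reverse_cons, linkCount_reverse]
    rw [linkCount_append_cons_cons, hrev, linkCount_append_cons_cons, h₂, adjInd_comm a u,
      adjInd_comm b v] at h₁
    rw [h, linkCount_append_cons_cons] at hk
    omega
  · obtain rfl : u = a := by simpa using (List.append_inj' h rfl).2
    exact G.irrefl
  · have h₁ := hG (X.reverse ++ a :: v :: B) (by
      rw [h, show X.reverse ++ a :: v :: B = (a :: X).reverse ++ v :: B by simp]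
      exact (List.reverse_perm _).append_right _)
    have h₂ : linkCount G (X.reverse ++ [a]) = linkCount G (a :: X) := by
      rw [← List.reverse_cons, linkCount_reverse]
    rw [linkCount_append_cons_cons, h₂, adjInd_eq_one hva.symm] at h₁
    rw [h] at hk
    omega

/-- If `u`, `v` are consecutive in an ordering of the vertices that would have at least `k` links
once `uv` is counted as one, and no ordering has `k` links in `G`, then `d(u) + d(v) < k`. -/
lemma degN_add_degN_lt_of_consecutive [Fintype V] {k : ℕ} {u v : V}
    (hG : ∀ l : List V, l.Nodup → linkCount G l < k) {A B : List V}
    (hnd : (A ++ u :: v :: B).Nodup) (hmem : ∀ x, x ∈ A ++ u :: v :: B)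
    (hk : k ≤ linkCount G (A ++ [u]) + linkCount G (v :: B) + 1) :
    degN G u + degN G v < k := by
  have hlt : ∀ l : List V, l.Perm (A ++ u :: v :: B) → linkCount G l < k :=
    fun l hl => hG l (hl.nodup_iff.mpr hnd)
  have hrevA : linkCount G (u :: A.reverse) = linkCount G (A ++ [u]) := by
    rw [← linkCount_reverse (A ++ [u])]; simp
  have hrevB : linkCount G (B.reverse ++ [v]) = linkCount G (v :: B) := by
    rw [← List.reverse_cons, linkCount_reverse]
  have hleft := sum_adjInd_left_le hlt hk
  have hright := sum_adjInd_left_le (G := G) (k := k) (u := v) (v := u) (A := B.reverse)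
    (B := A.reverse) (fun l hl => hlt l (hl.trans (by
      rw [show B.reverse ++ v :: u :: A.reverse = (A ++ u :: v :: B).reverse by simp]
      exact List.reverse_perm _))) (by omega)
  rw [hrevB] at hright
  have h := hlt _ (List.Perm.refl _)
  rw [linkCount_append_cons_cons] at h
  rw [degN_eq_sum u hnd hmem, degN_eq_sum v hnd hmem]
  simp only [List.map_append, List.sum_append, List.map_cons, List.sum_cons, List.map_nil,
    List.sum_nil, List.map_reverse, List.sum_reverse] at hleft hright ⊢
  omega

end LinkCount

/-- Ning–Wang closure lemma. If `u, v` are distinct non-adjacent vertices of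
`G` with `d_G(u) + d_G(v) ≥ k`, then `G` is `𝓛ₖ`-free iff `G + uv` is `𝓛ₖ`-free. -/
theorem statement9 {V : Type*} [Fintype V] (G : SimpleGraph V) (k : ℕ) (u v : V)
    (hne : u ≠ v) (hadj : ¬ G.Adj u v) (hdeg : k ≤ degN G u + degN G v) :
    LinearForestFree k G ↔ LinearForestFree k (G ⊔ SimpleGraph.fromEdgeSet {s(u, v)}) := by
  classical
  refine ⟨fun hG H hHG hH hcard => ?_, fun hG H hHG hH => hG H (hHG.trans le_sup_left) hH⟩
  obtain ⟨l, hnd, hmem, hl⟩ := hH.exists_list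
  have hl' := hl.trans (linkCount_mono hHG l)
  rw [hcard] at hl'
  have hlt : ∀ l : List V, l.Nodup → linkCount G l < k := fun l => hG.linkCount_lt
  have key : ∀ A B : List V, l = A ++ u :: v :: B ∨ l.reverse = A ++ u :: v :: B → False := by
    intro A B h
    obtain ⟨hnd', hmem', hk⟩ : (A ++ u :: v :: B).Nodup ∧ (∀ x, x ∈ A ++ u :: v :: B) ∧
        k ≤ linkCount (G ⊔ SimpleGraph.fromEdgeSet {s(u, v)}) (A ++ u :: v :: B) := by
      rcases h with h | h
      · rw [← h]; exact ⟨hnd, hmem, hl'⟩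
      · rw [← h, linkCount_reverse]
        exact ⟨List.nodup_reverse.mpr hnd, by simpa using hmem, hl'⟩
    have hu : u ∉ v :: B := (List.nodup_cons.mp (List.nodup_append.mp hnd').2.1).1
    have hv : v ∉ A ++ [u] := by
      rw [← List.singleton_append, ← List.append_assoc] at hnd'
      intro hv
      exact (List.nodup_append.mp hnd').2.2 v hv v List.mem_cons_self rfl
    rw [linkCount_append_cons_cons, linkCount_add_edge_of_notMem (Or.inr hv),
      linkCount_add_edge_of_notMem (Or.inl hu)] at hk
    have h₁ := adjInd_le_one (G := G ⊔ SimpleGraph.fromEdgeSet {s(u, v)}) u v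
    have := degN_add_degN_lt_of_consecutive hlt hnd' hmem' (by omega)
    omega
  rcases linkCount_add_edge_le_or_exists (G := G) u v l with h | ⟨A, B, h | h⟩
  · exact absurd (hlt l hnd) (by omega)
  · exact key A B (Or.inl h)
  · exact key B.reverse A.reverse (Or.inr (by simp [h]))
end
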